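/- arXiv:2104.08959 — 10 statements merged into one kernel-verified Lean document; each statement's English description precedes it below -/
import Mathlib

section
/- Let L and D be positive integers, c ∈ ℝ^L, Γ an L×L symmetric positive definite real matrix, A ∈ ℝ^{D×L}, b ∈ ℝ^D, and Σ a D×D symmetric positive definite real matrix. Define Γ* = Σ + A Γ Aᵀ, Σ* = (Γ⁻¹ + Aᵀ Σ⁻¹ A)⁻¹, A* = Σ* Aᵀ Σ⁻¹, b* = Σ* (Γ⁻¹ c − Aᵀ Σ⁻¹ b), and c* = A c + b. Then Γ* and Σ* are symmetric positive definite, and for every x ∈ ℝ^D and y ∈ ℝ^L one has Φ_D(x; A y + b, Σ) · Φ_L(y; c, Γ) = Φ_L(y; A* x + b*, Σ*) · Φ_D(x; c*, Γ*). (This is the one-to-one correspondence between the inverse and forward parameterizations of a Gaussian locally-linear mapping model.) -/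
open Matrix

/-- Gaussian density `Φ_d(x; μ, Σ)` on `ℝ^d`. -/
noncomputable def gaussianPdf (d : ℕ) (μ : Fin d → ℝ) (S : Matrix (Fin d) (Fin d) ℝ)
    (x : Fin d → ℝ) : ℝ :=
  (2 * Real.pi) ^ (-(d : ℝ) / 2) * S.det ^ (-(1 : ℝ) / 2) *
    Real.exp (-(1 / 2 : ℝ) * ((x - μ) ⬝ᵥ (S⁻¹ *ᵥ (x - μ))))

theorem gllim_quad {m n : Type*} [Fintype m] [Fintype n] [DecidableEq m] [DecidableEq n]
    (G P T : Matrix n n ℝ) (A : Matrix m n ℝ) (R : Matrix m m ℝ) (hR : Rᵀ = R) (hPs : Pᵀ = P)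
    (hP : P = G + Aᵀ * R * A) (hPT : P * T = 1) (u : m → ℝ) (v : n → ℝ) :
    (u - A *ᵥ v) ⬝ᵥ (R *ᵥ (u - A *ᵥ v)) + v ⬝ᵥ (G *ᵥ v) =
      (v - T *ᵥ ((Aᵀ * R) *ᵥ u)) ⬝ᵥ (P *ᵥ (v - T *ᵥ ((Aᵀ * R) *ᵥ u)))
        + u ⬝ᵥ ((R - R * A * T * Aᵀ * R) *ᵥ u) := by
  have hG : G = P - Aᵀ * R * A := by rw [hP]; abel
  have e0 : R * A * T * Aᵀ * R = (R * A) * (T * (Aᵀ * R)) := by simp only [Matrix.mul_assoc]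
  set w := (Aᵀ * R) *ᵥ u with hw
  set z := T *ᵥ w with hz
  have hPz : P *ᵥ z = w := by rw [hz, mulVec_mulVec, hPT, one_mulVec]
  have sw : ∀ a : n → ℝ, u ⬝ᵥ ((R * A) *ᵥ a) = a ⬝ᵥ w := by
    intro a
    rw [hw, dotProduct_mulVec, ← mulVec_transpose, transpose_mul, hR, dotProduct_comm]
  have e1 : u ⬝ᵥ ((R - R * A * T * Aᵀ * R) *ᵥ u) = u ⬝ᵥ (R *ᵥ u) - z ⬝ᵥ w := by
    rw [sub_mulVec, dotProduct_sub, e0, ← mulVec_mulVec, sw, ← mulVec_mulVec]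
  have e2 : z ⬝ᵥ (P *ᵥ v) = v ⬝ᵥ w := by
    rw [dotProduct_mulVec, ← mulVec_transpose, hPs, hPz, dotProduct_comm]
  have e3 : (A *ᵥ v) ⬝ᵥ (R *ᵥ u) = v ⬝ᵥ w := by
    rw [hw, ← mulVec_mulVec, dotProduct_mulVec v, vecMul_transpose]
  have e4 : (A *ᵥ v) ⬝ᵥ (R *ᵥ (A *ᵥ v)) = v ⬝ᵥ ((Aᵀ * R * A) *ᵥ v) := by
    rw [← mulVec_mulVec, ← mulVec_mulVec, dotProduct_mulVec v, vecMul_transpose]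
  have e5 : u ⬝ᵥ (R *ᵥ (A *ᵥ v)) = v ⬝ᵥ w := by rw [mulVec_mulVec, sw]
  rw [e1, hG]
  simp only [mulVec_sub, sub_mulVec, dotProduct_sub, sub_dotProduct, hPz, e2, e3, e4, e5]
  ring

/-- One-to-one correspondence between the inverse and forward parameterizations of a
Gaussian locally-linear mapping model. -/
theorem gllim_inverse_forward_correspondence
    (L D : ℕ) (hL : 0 < L) (hD : 0 < D)
    (c : Fin L → ℝ) (Γ : Matrix (Fin L) (Fin L) ℝ) (hΓ : Γ.PosDef)
    (A : Matrix (Fin D) (Fin L) ℝ) (b : Fin D → ℝ)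
    (S : Matrix (Fin D) (Fin D) ℝ) (hS : S.PosDef) :
    (S + A * Γ * Aᵀ).PosDef ∧ ((Γ⁻¹ + Aᵀ * S⁻¹ * A)⁻¹).PosDef ∧
    ∀ (x : Fin D → ℝ) (y : Fin L → ℝ),
      gaussianPdf D (A *ᵥ y + b) S x * gaussianPdf L c Γ y =
        gaussianPdf L
          (((Γ⁻¹ + Aᵀ * S⁻¹ * A)⁻¹ * Aᵀ * S⁻¹) *ᵥ x
            + (Γ⁻¹ + Aᵀ * S⁻¹ * A)⁻¹ *ᵥ (Γ⁻¹ *ᵥ c - (Aᵀ * S⁻¹) *ᵥ b))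
          ((Γ⁻¹ + Aᵀ * S⁻¹ * A)⁻¹) y
        * gaussianPdf D (A *ᵥ c + b) (S + A * Γ * Aᵀ) x := by
  have hM : (S + A * Γ * Aᵀ).PosDef := by
    have := hΓ.posSemidef.mul_mul_conjTranspose_same A
    rw [conjTranspose_eq_transpose_of_trivial] at this
    exact hS.add_posSemidef this
  have hP : (Γ⁻¹ + Aᵀ * S⁻¹ * A).PosDef := by
    have := hS.inv.posSemidef.conjTranspose_mul_mul_same A
    rw [conjTranspose_eq_transpose_of_trivial] at this
    exact hΓ.inv.add_posSemidef this
  refine ⟨hM, hP.inv, fun x y => ?_⟩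
  have hSdet := (isUnit_iff_isUnit_det _).1 hS.isUnit
  have hΓdet := (isUnit_iff_isUnit_det _).1 hΓ.isUnit
  have hPdet := (isUnit_iff_isUnit_det _).1 hP.isUnit
  have hinv := add_mul_mul_inv_eq_sub (A := S) (U := A) (C := Γ) (V := Aᵀ)
    hS.isUnit hΓ.isUnit hP.isUnit
  have hdet : (S + A * Γ * Aᵀ).det = S.det * Γ.det * (Γ⁻¹ + Aᵀ * S⁻¹ * A).det := by
    rw [Matrix.mul_assoc, det_add_mul _ _ hSdet, mul_assoc, ← det_mul, Matrix.mul_add,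
      mul_nonsing_inv _ hΓdet]
    simp only [Matrix.mul_assoc]
  have hq := gllim_quad Γ⁻¹ _ _ A S⁻¹
    ((conjTranspose_eq_transpose_of_trivial _).symm.trans hS.inv.isHermitian)
    ((conjTranspose_eq_transpose_of_trivial _).symm.trans hP.isHermitian) rfl (mul_nonsing_inv _ hPdet)
    (x - (A *ᵥ c + b)) (y - c)
  have hPi : ((Γ⁻¹ + Aᵀ * S⁻¹ * A)⁻¹)⁻¹ = Γ⁻¹ + Aᵀ * S⁻¹ * A := nonsing_inv_nonsing_inv _ hPdet
  have h1 : x - (A *ᵥ c + b) - A *ᵥ (y - c) = x - (A *ᵥ y + b) := by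
    rw [mulVec_sub]; abel
  have h2 : y - c - (Γ⁻¹ + Aᵀ * S⁻¹ * A)⁻¹ *ᵥ ((Aᵀ * S⁻¹) *ᵥ (x - (A *ᵥ c + b))) =
      y - (((Γ⁻¹ + Aᵀ * S⁻¹ * A)⁻¹ * Aᵀ * S⁻¹) *ᵥ x
            + (Γ⁻¹ + Aᵀ * S⁻¹ * A)⁻¹ *ᵥ (Γ⁻¹ *ᵥ c - (Aᵀ * S⁻¹) *ᵥ b)) := by
    have hc : c = (Γ⁻¹ + Aᵀ * S⁻¹ * A)⁻¹ *ᵥ (Γ⁻¹ *ᵥ c + (Aᵀ * S⁻¹) *ᵥ (A *ᵥ c)) := by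
      rw [mulVec_mulVec, ← add_mulVec, mulVec_mulVec, nonsing_inv_mul _ hPdet, one_mulVec]
    rw [Matrix.mul_assoc _ Aᵀ, ← mulVec_mulVec x, sub_sub]
    congr 1
    nth_rewrite 1 [hc]
    simp only [mulVec_sub, mulVec_add]
    abel
  rw [h1, h2, ← hinv] at hq
  unfold gaussianPdf
  rw [hPi]
  have hd : S.det ^ (-(1 : ℝ) / 2) * Γ.det ^ (-(1 : ℝ) / 2) =
      ((Γ⁻¹ + Aᵀ * S⁻¹ * A)⁻¹).det ^ (-(1 : ℝ) / 2) *
        (S + A * Γ * Aᵀ).det ^ (-(1 : ℝ) / 2) := by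
    rw [← Real.mul_rpow hS.det_pos.le hΓ.det_pos.le,
      ← Real.mul_rpow hP.inv.det_pos.le hM.det_pos.le, hdet, det_nonsing_inv,
      Ring.inverse_eq_inv']
    have := hP.det_pos.ne'
    congr 1
    field_simp
  have he : ∀ p q r s : ℝ, p + q = r + s →
      Real.exp (-(1 / 2 : ℝ) * p) * Real.exp (-(1 / 2 : ℝ) * q) =
      Real.exp (-(1 / 2 : ℝ) * r) * Real.exp (-(1 / 2 : ℝ) * s) := by
    intro p q r s h
    rw [← Real.exp_add, ← Real.exp_add, ← mul_add, ← mul_add, h]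
  rw [mul_mul_mul_comm, mul_mul_mul_comm (_ ^ _), hd, he _ _ _ _ hq]
  ring
end

section
/- Let D be a positive integer, μ₁, μ₂ ∈ ℝ^D, and Σ₁, Σ₂ be D×D symmetric positive definite real matrices such that Σ₂ − Σ₁ is positive definite. Then for all x ∈ ℝ^D, Φ_D(x; μ₁, Σ₁) / Φ_D(x; μ₂, Σ₂) ≤ √(det Σ₂ / det Σ₁) · exp( (1/2) (μ₁ − μ₂)ᵀ (Σ₂ − Σ₁)⁻¹ (μ₁ − μ₂) ). -/
open Matrix

theorem fenchel_aux {D : ℕ} (A : Matrix (Fin D) (Fin D) ℝ) (hA : A.PosDef)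
    (w u : Fin D → ℝ) :
    2 * (w ⬝ᵥ u) - w ⬝ᵥ (A *ᵥ w) ≤ u ⬝ᵥ (A⁻¹ *ᵥ u) := by
  have hu : A *ᵥ (A⁻¹ *ᵥ u) = u := by
    rw [Matrix.mulVec_mulVec, Matrix.mul_nonsing_inv _ hA.det_pos.ne'.isUnit, Matrix.one_mulVec]
  generalize A⁻¹ *ᵥ u = t at hu
  have hT : Aᵀ = A := by
    have := hA.isHermitian.eq
    rwa [Matrix.conjTranspose_eq_transpose_of_trivial] at this
  have h := hA.posSemidef.dotProduct_mulVec_nonneg (t - w)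
  have hs : t ⬝ᵥ (A *ᵥ w) = w ⬝ᵥ u := by
    rw [Matrix.dotProduct_mulVec, ← Matrix.mulVec_transpose, hT, hu, dotProduct_comm]
  simp only [star_trivial, Matrix.mulVec_sub, sub_dotProduct, dotProduct_sub, hu, hs] at h
  rw [dotProduct_comm u t]
  linarith

theorem quad_aux {D : ℕ} (S₁ S₂ : Matrix (Fin D) (Fin D) ℝ) (hS₁ : S₁.PosDef) (hS₂ : S₂.PosDef)
    (hdiff : (S₂ - S₁).PosDef) (u v : Fin D → ℝ) :
    (u + v) ⬝ᵥ (S₂⁻¹ *ᵥ (u + v)) ≤ u ⬝ᵥ (S₁⁻¹ *ᵥ u) + v ⬝ᵥ ((S₂ - S₁)⁻¹ *ᵥ v) := by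
  have hu : S₂ *ᵥ (S₂⁻¹ *ᵥ (u + v)) = u + v := by
    rw [Matrix.mulVec_mulVec, Matrix.mul_nonsing_inv _ hS₂.det_pos.ne'.isUnit, Matrix.one_mulVec]
  generalize S₂⁻¹ *ᵥ (u + v) = w at hu
  have h1 := fenchel_aux S₁ hS₁ w u
  have h2 := fenchel_aux _ hdiff w v
  rw [Matrix.sub_mulVec, hu] at h2
  simp only [dotProduct_sub, dotProduct_add, add_dotProduct] at h2 ⊢
  rw [dotProduct_comm u w, dotProduct_comm v w]
  linarith

/-- Ratio bound for two Gaussian densities when `Σ₂ − Σ₁` is positive definite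
(Proposition C.1 of Maugis–Michel). -/
theorem gaussian_ratio_bound
    (D : ℕ) (hD : 0 < D) (μ₁ μ₂ : Fin D → ℝ)
    (S₁ S₂ : Matrix (Fin D) (Fin D) ℝ) (hS₁ : S₁.PosDef) (hS₂ : S₂.PosDef)
    (hdiff : (S₂ - S₁).PosDef) :
    ∀ x : Fin D → ℝ,
      gaussianPdf D μ₁ S₁ x / gaussianPdf D μ₂ S₂ x ≤
        Real.sqrt (S₂.det / S₁.det) *
          Real.exp ((1 / 2 : ℝ) * ((μ₁ - μ₂) ⬝ᵥ ((S₂ - S₁)⁻¹ *ᵥ (μ₁ - μ₂)))) := by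
  intro x
  have d1 := hS₁.det_pos
  have d2 := hS₂.det_pos
  have hq := quad_aux S₁ S₂ hS₁ hS₂ hdiff (x - μ₁) (μ₁ - μ₂)
  rw [sub_add_sub_cancel] at hq
  have hp : (0 : ℝ) < (2 * Real.pi) ^ (-(D : ℝ) / 2) := by positivity
  have e : ∀ a : ℝ, 0 < a → a ^ (-(1 : ℝ) / 2) = (Real.sqrt a)⁻¹ := by
    intro a ha
    rw [neg_div, Real.rpow_neg ha.le, Real.sqrt_eq_rpow]
  have s1 := Real.sqrt_pos.2 d1
  have s2 := Real.sqrt_pos.2 d2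
  unfold gaussianPdf
  rw [e _ d1, e _ d2, Real.sqrt_div d2.le, mul_div_mul_comm, mul_div_mul_left _ _ hp.ne',
    ← Real.exp_sub, inv_div_inv]
  refine mul_le_mul_of_nonneg_left (Real.exp_le_exp.2 ?_) (by positivity)
  linarith
end

section
/- Let D be a positive integer, λ_m > 0, and 0 < ε < λ_m/3; set α = 3ε/λ_m. Let Σ be a D×D symmetric positive definite real matrix whose smallest eigenvalue is at least λ_m, and let Σ̃ be a D×D symmetric real matrix with ‖Σ − Σ̃‖₂ ≤ ε in spectral norm. Then Σ̃ is positive definite, the matrices (1+α)Σ̃ − Σ and Σ − (1+α)⁻¹Σ̃ are positive definite, and moreover for all x ∈ ℝ^D one has xᵀ((1+α)Σ̃ − Σ)x ≥ ε‖x‖₂² and xᵀ(Σ − (1+α)⁻¹Σ̃)x ≥ ε‖x‖₂². -/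
open Matrix

/-- Spectral norm of a real square matrix: the operator norm induced by the Euclidean norm. -/
noncomputable def specNorm {D : ℕ} (M : Matrix (Fin D) (Fin D) ℝ) : ℝ :=
  ‖LinearMap.toContinuousLinearMap (Matrix.toEuclideanLin M)‖

theorem aux_lower {D : ℕ} (lm : ℝ) (S : Matrix (Fin D) (Fin D) ℝ) (h : S.IsHermitian)
    (hev : ∀ i, lm ≤ h.eigenvalues i) (x : Fin D → ℝ) :
    lm * (x ⬝ᵥ x) ≤ x ⬝ᵥ (S *ᵥ x) := by
  have hp : (S - algebraMap ℝ _ lm).PosSemidef := by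
    rw [Matrix.posSemidef_iff_isHermitian_and_spectrum_nonneg]
    refine ⟨h.sub ?_, ?_⟩
    · rw [Matrix.algebraMap_eq_diagonal]
      exact Matrix.isHermitian_diagonal _
    · intro a ha
      rw [← spectrum.sub_singleton_eq, h.spectrum_real_eq_range_eigenvalues] at ha
      obtain ⟨_, ⟨i, rfl⟩, _, rfl, rfl⟩ := ha
      simpa using hev i
  have := hp.dotProduct_mulVec_nonneg x
  rw [Algebra.algebraMap_eq_smul_one, Matrix.sub_mulVec, Matrix.smul_mulVec, Matrix.one_mulVec,
    dotProduct_sub, dotProduct_smul, star_trivial, smul_eq_mul] at this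
  linarith

theorem aux_near {D : ℕ} (ε : ℝ) (M : Matrix (Fin D) (Fin D) ℝ) (h : specNorm M ≤ ε)
    (x : Fin D → ℝ) : |x ⬝ᵥ (M *ᵥ x)| ≤ ε * (x ⬝ᵥ x) := by
  have h1 := (LinearMap.toContinuousLinearMap (Matrix.toEuclideanLin M)).le_of_opNorm_le h
    (WithLp.toLp 2 x)
  have h2 := abs_real_inner_le_norm (WithLp.toLp 2 x)
    (LinearMap.toContinuousLinearMap (Matrix.toEuclideanLin M) (WithLp.toLp 2 x))
  have h3 : inner ℝ (WithLp.toLp 2 x)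
      (LinearMap.toContinuousLinearMap (Matrix.toEuclideanLin M) (WithLp.toLp 2 x))
      = x ⬝ᵥ (M *ᵥ x) := by
    simp [EuclideanSpace.inner_eq_star_dotProduct, dotProduct_comm]
  have h4 : ‖WithLp.toLp 2 x‖ * ‖WithLp.toLp 2 x‖ = x ⬝ᵥ x := by
    rw [← real_inner_self_eq_norm_mul_norm]
    rw [EuclideanSpace.inner_eq_star_dotProduct, star_trivial]
  rw [h3] at h2
  rw [← h4]
  nlinarith [norm_nonneg (WithLp.toLp 2 x)]

theorem aux_pd {D : ℕ} (c : ℝ) (hc : 0 < c) (M : Matrix (Fin D) (Fin D) ℝ) (h : M.IsHermitian)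
    (hx : ∀ x : Fin D → ℝ, c * (x ⬝ᵥ x) ≤ x ⬝ᵥ (M *ᵥ x)) : M.PosDef := by
  refine Matrix.PosDef.of_dotProduct_mulVec_pos h fun x hx0 => ?_
  have h1 : 0 < x ⬝ᵥ x := by
    simpa using Matrix.dotProduct_star_self_pos_iff.2 hx0
  rw [star_trivial]
  exact (mul_pos hc h1).trans_le (hx x)


/-- Lemma on positive definiteness of `(1+α)Σ̃ − Σ` and `Σ − (1+α)⁻¹Σ̃`
(similar to Lemma B.8 of Maugis–Michel). -/
theorem posdef_perturbation
    (D : ℕ) (hD : 0 < D) (lm ε α : ℝ) (hlm : 0 < lm) (hε0 : 0 < ε) (hε : ε < lm / 3)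
    (hα : α = 3 * ε / lm)
    (S : Matrix (Fin D) (Fin D) ℝ) (hS : S.PosDef)
    (hev : ∀ h : S.IsHermitian, ∀ i, lm ≤ h.eigenvalues i)
    (St : Matrix (Fin D) (Fin D) ℝ) (hSt : St.IsHermitian)
    (hnear : specNorm (S - St) ≤ ε) :
    St.PosDef ∧ ((1 + α) • St - S).PosDef ∧ (S - (1 + α)⁻¹ • St).PosDef ∧
    ∀ x : Fin D → ℝ,
      ε * (x ⬝ᵥ x) ≤ x ⬝ᵥ (((1 + α) • St - S) *ᵥ x) ∧
      ε * (x ⬝ᵥ x) ≤ x ⬝ᵥ ((S - (1 + α)⁻¹ • St) *ᵥ x) := by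
  have hH : S.IsHermitian := hS.1
  have key : ∀ x : Fin D → ℝ, (lm - ε) * (x ⬝ᵥ x) ≤ x ⬝ᵥ (St *ᵥ x) ∧
      ε * (x ⬝ᵥ x) ≤ x ⬝ᵥ (((1 + α) • St - S) *ᵥ x) ∧
      ε * (x ⬝ᵥ x) ≤ x ⬝ᵥ ((S - (1 + α)⁻¹ • St) *ᵥ x) := by
    intro x
    have h1 := aux_lower lm S hH (hev hH) x
    have h2 := aux_near ε _ hnear x
    have hn : 0 ≤ x ⬝ᵥ x := 
      Finset.sum_nonneg fun i _ => mul_self_nonneg (x i)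
    simp only [Matrix.sub_mulVec, Matrix.smul_mulVec, dotProduct_sub, dotProduct_smul,
      smul_eq_mul] at h2 ⊢
    generalize x ⬝ᵥ x = n at *
    generalize x ⬝ᵥ (S *ᵥ x) = s at *
    generalize x ⬝ᵥ (St *ᵥ x) = t at *
    obtain ⟨h2, h3⟩ := abs_le.1 h2
    have hα0 : 0 < α := by rw [hα]; positivity
    have hα1 : α < 1 := by rw [hα, div_lt_one hlm]; linarith
    have hal : α * lm = 3 * ε := by rw [hα]; field_simp
    have h4 : (lm - ε) * n ≤ t := by linarith
    have hεn : 0 ≤ ε * n := by positivity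
    have h6 : α * (ε * n) ≤ ε * n := by nlinarith
    refine ⟨h4, ?_, ?_⟩
    · have h5 := mul_le_mul_of_nonneg_left h4 hα0.le
      have h7 : α * ((lm - ε) * n) = 3 * (ε * n) - α * (ε * n) := by
        linear_combination n * hal
      linarith
    · have h5 := mul_le_mul_of_nonneg_left h1 hα0.le
      have h7 : α * (lm * n) = 3 * (ε * n) := by linear_combination n * hal
      have h8 : (1 + α)⁻¹ * t ≤ s - ε * n := by
        rw [inv_mul_le_iff₀ (by linarith)]
        linarith
      linarith
  refine ⟨aux_pd (lm - ε) (by linarith) _ hSt fun x => (key x).1,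
    aux_pd ε hε0 _ ?_ fun x => (key x).2.1, aux_pd ε hε0 _ ?_ fun x => (key x).2.2,
    fun x => (key x).2⟩
  · exact (hSt.smul (IsSelfAdjoint.all _)).sub hH
  · exact hH.sub (hSt.smul (IsSelfAdjoint.all _))
end

section
/- Let D be a positive integer, λ_m > 0, 0 < ε < λ_m/3, and α = 3ε/λ_m. Let Σ be a D×D symmetric positive definite matrix with smallest eigenvalue at least λ_m, and Σ̃ a D×D symmetric matrix with ‖Σ − Σ̃‖₂ ≤ ε in spectral norm. Let υ, υ̃ ∈ ℝ^D, and define f(x) = Φ_D(x; υ, Σ), l(x) = (1+2α)^{−D} Φ_D(x; υ̃, (1+α)⁻¹Σ̃), u(x) = (1+2α)^{D} Φ_D(x; υ̃, (1+α)Σ̃). Then for all x ∈ ℝ^D, max{ l(x)/f(x), f(x)/u(x) } ≤ (1+2α)^{−D/2} exp( ‖υ − υ̃‖₂² / (2ε) ). -/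
open Matrix

lemma quad_psd {D : ℕ} {M : Matrix (Fin D) (Fin D) ℝ} (hM : M.IsHermitian)
    (h : ∀ v : Fin D → ℝ, 0 ≤ v ⬝ᵥ (M *ᵥ v)) : M.PosSemidef :=
  PosSemidef.of_dotProduct_mulVec_nonneg hM (by simpa using h)

lemma quad_symm {D : ℕ} {M : Matrix (Fin D) (Fin D) ℝ} (hM : M.IsHermitian)
    (v w : Fin D → ℝ) : v ⬝ᵥ (M *ᵥ w) = w ⬝ᵥ (M *ᵥ v) := by
  have h : Mᵀ = M := by simpa [Matrix.IsHermitian] using hM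
  rw [dotProduct_mulVec, ← mulVec_transpose, h, dotProduct_comm]

open scoped MatrixOrder in
lemma psd_factor {D : ℕ} {B : Matrix (Fin D) (Fin D) ℝ} (hB : B.PosSemidef) :
    ∃ C : Matrix (Fin D) (Fin D) ℝ, B = Cᴴ * C := by
  obtain ⟨C, hC⟩ := CStarAlgebra.nonneg_iff_eq_star_mul_self.mp hB.nonneg
  exact ⟨C, hC⟩

lemma det_mono_aux {D : ℕ} {A B : Matrix (Fin D) (Fin D) ℝ} (hA : A.PosDef) (hB : B.PosDef)
    (h : ∀ v : Fin D → ℝ, v ⬝ᵥ (A *ᵥ v) ≤ v ⬝ᵥ (B *ᵥ v)) : A.det ≤ B.det := by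
  obtain ⟨C, hC⟩ := psd_factor hB.posSemidef
  have hdB : B.det = C.det * C.det := by
    rw [hC, det_mul, det_conjTranspose]; simp
  have hBpos := hB.det_pos
  have hCu : IsUnit C.det := by
    rw [isUnit_iff_ne_zero]; intro h0; rw [hdB, h0] at hBpos; simp at hBpos
  have hM : ((C⁻¹)ᴴ * A * C⁻¹).PosSemidef := hA.posSemidef.conjTranspose_mul_mul_same _
  have hCC : C * C⁻¹ = 1 := mul_nonsing_inv _ hCu
  have key : ∀ v : Fin D → ℝ, v ⬝ᵥ (((C⁻¹)ᴴ * A * C⁻¹) *ᵥ v) ≤ v ⬝ᵥ v := by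
    intro v
    have h1 := h (C⁻¹ *ᵥ v)
    have e1 : ∀ X : Matrix (Fin D) (Fin D) ℝ,
        v ⬝ᵥ (((C⁻¹)ᴴ * X * C⁻¹) *ᵥ v) = (C⁻¹ *ᵥ v) ⬝ᵥ (X *ᵥ (C⁻¹ *ᵥ v)) := by
      intro X
      rw [← mulVec_mulVec, ← mulVec_mulVec, dotProduct_mulVec, conjTranspose_eq_transpose_of_trivial,
        vecMul_transpose]
    have e2 : (C⁻¹)ᴴ * B * C⁻¹ = 1 := by
      rw [hC, ← Matrix.mul_assoc, ← conjTranspose_mul, Matrix.mul_assoc, hCC]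
      simp
    rw [← e1, ← e1, e2, one_mulVec] at h1
    exact h1
  have hdet : ((C⁻¹)ᴴ * A * C⁻¹).det ≤ 1 := by
    rw [hM.1.det_eq_prod_eigenvalues]
    apply Finset.prod_le_one
    · intro i _; simpa using hM.eigenvalues_nonneg i
    · intro i _
      have h1 := hM.1.eigenvalues_eq i
      have h2 := key (hM.1.eigenvectorBasis i)
      have h3 : (hM.1.eigenvectorBasis i).ofLp ⬝ᵥ (hM.1.eigenvectorBasis i).ofLp = 1 := by
        have := hM.1.eigenvectorBasis.orthonormal.1 i
        have h4 := real_inner_self_eq_norm_sq (hM.1.eigenvectorBasis i)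
        rw [this, EuclideanSpace.inner_eq_star_dotProduct] at h4
        simpa using h4
      simp only [star_trivial, RCLike.re_to_real] at h1
      simp only [RCLike.ofReal_real_eq_id, id]
      rw [h1]; linarith
  have : A.det = B.det * ((C⁻¹)ᴴ * A * C⁻¹).det := by
    have h5 : C.det * (C⁻¹).det = 1 := by rw [← det_mul, hCC, det_one]
    rw [det_mul, det_mul, det_conjTranspose, hdB, star_trivial]
    linear_combination (-(A.det) * (C.det * (C⁻¹).det + 1)) * h5
  rw [this]
  nlinarith

lemma inv_quad {D : ℕ} {P Q : Matrix (Fin D) (Fin D) ℝ} (hP : P.PosDef) (hQ : Q.PosDef)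
    {ε : ℝ} (hε : 0 < ε)
    (h : ∀ v : Fin D → ℝ, v ⬝ᵥ (Q *ᵥ v) + ε * (v ⬝ᵥ v) ≤ v ⬝ᵥ (P *ᵥ v)) (y z : Fin D → ℝ) :
    z ⬝ᵥ (P⁻¹ *ᵥ z) - y ⬝ᵥ (Q⁻¹ *ᵥ y) ≤ ((z - y) ⬝ᵥ (z - y)) / ε := by
  have hPu : IsUnit P.det := hP.det_pos.ne'.isUnit
  have hQu : IsUnit Q.det := hQ.det_pos.ne'.isUnit
  obtain ⟨w, hw⟩ : ∃ w, w = P⁻¹ *ᵥ z := ⟨_, rfl⟩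
  obtain ⟨t, ht⟩ : ∃ t, t = Q⁻¹ *ᵥ y := ⟨_, rfl⟩
  have hz : z = P *ᵥ w := by rw [hw, mulVec_mulVec, mul_nonsing_inv _ hPu, one_mulVec]
  have hy : y = Q *ᵥ t := by rw [ht, mulVec_mulVec, mul_nonsing_inv _ hQu, one_mulVec]
  obtain ⟨d, hd⟩ : ∃ d, d = z - y := ⟨_, rfl⟩
  have h1 := h w
  have h2 := hQ.posSemidef.dotProduct_mulVec_nonneg (w - t)
  simp only [star_trivial, mulVec_sub, sub_dotProduct, dotProduct_sub] at h2
  rw [quad_symm hQ.1 t w] at h2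
  have h3 : 0 ≤ (ε • w - d) ⬝ᵥ (ε • w - d) := by
    simpa using dotProduct_star_self_nonneg (ε • w - d)
  simp only [sub_dotProduct, dotProduct_sub, smul_dotProduct, dotProduct_smul, smul_eq_mul] at h3
  rw [dotProduct_comm d w] at h3
  have h4 : w ⬝ᵥ d = w ⬝ᵥ (P *ᵥ w) - w ⬝ᵥ (Q *ᵥ t) := by rw [hd, dotProduct_sub, ← hz, ← hy]
  rw [← hw, ← ht, ← hd, le_div_iff₀ hε, dotProduct_comm z, dotProduct_comm y]
  rw [h4] at h3
  rw [← hy] at *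
  rw [← hz] at *
  nlinarith

lemma ratio_aux {D : ℕ} {P Q : Matrix (Fin D) (Fin D) ℝ} (hP : P.PosDef) (hQ : Q.PosDef)
    {ε c : ℝ} (hε : 0 < ε) (hc : 0 < c)
    (h : ∀ v : Fin D → ℝ, v ⬝ᵥ (Q *ᵥ v) + ε * (v ⬝ᵥ v) ≤ v ⬝ᵥ (P *ᵥ v))
    (h' : ∀ v : Fin D → ℝ, v ⬝ᵥ (P *ᵥ v) ≤ c * (v ⬝ᵥ (Q *ᵥ v))) (a b x : Fin D → ℝ) :
    c ^ (-(D : ℝ)) * gaussianPdf D a Q x / gaussianPdf D b P x ≤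
      c ^ (-(D : ℝ) / 2) * Real.exp (((a - b) ⬝ᵥ (a - b)) / (2 * ε)) := by
  have hPd := hP.det_pos
  have hQd := hQ.det_pos
  have hdet : P.det ≤ c ^ (D : ℝ) * Q.det := by
    have := det_mono_aux hP (hQ.smul hc) (by
      intro v; simpa [smul_mulVec, dotProduct_smul] using h' v)
    simpa [det_smul] using this
  have hexp := inv_quad hP hQ hε h (x - a) (x - b)
  have hsub : x - b - (x - a) = a - b := by abel
  rw [hsub] at hexp
  unfold gaussianPdf
  rw [div_le_iff₀ (by positivity)]
  have e1 : Real.exp (-(1 / 2 : ℝ) * ((x - a) ⬝ᵥ (Q⁻¹ *ᵥ (x - a)))) ≤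
      Real.exp (((a - b) ⬝ᵥ (a - b)) / (2 * ε)) *
      Real.exp (-(1 / 2 : ℝ) * ((x - b) ⬝ᵥ (P⁻¹ *ᵥ (x - b)))) := by
    rw [← Real.exp_add, Real.exp_le_exp]
    have : ((a - b) ⬝ᵥ (a - b)) / (2 * ε) = ((a - b) ⬝ᵥ (a - b)) / ε / 2 := by
      field_simp
    rw [this]; linarith
  have e2 : c ^ (-(D : ℝ)) * Q.det ^ (-(1 : ℝ) / 2) ≤
      c ^ (-(D : ℝ) / 2) * P.det ^ (-(1 : ℝ) / 2) := by
    have h1 : (c ^ (D : ℝ) * Q.det) ^ (-(1 : ℝ) / 2) ≤ P.det ^ (-(1 : ℝ) / 2) :=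
      Real.rpow_le_rpow_of_nonpos hPd hdet (by norm_num)
    rw [Real.mul_rpow (by positivity) hQd.le, ← Real.rpow_mul hc.le] at h1
    have h2 : c ^ (-(D : ℝ)) = c ^ (-(D : ℝ) / 2) * c ^ ((D : ℝ) * (-(1 : ℝ) / 2)) := by
      rw [← Real.rpow_add hc]; congr 1; ring
    rw [h2, mul_assoc]
    gcongr
  calc _ = (2 * Real.pi) ^ (-(D : ℝ) / 2) * ((c ^ (-(D : ℝ)) * Q.det ^ (-(1 : ℝ) / 2)) *
        Real.exp (-(1 / 2 : ℝ) * ((x - a) ⬝ᵥ (Q⁻¹ *ᵥ (x - a))))) := by ring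
    _ ≤ (2 * Real.pi) ^ (-(D : ℝ) / 2) * ((c ^ (-(D : ℝ) / 2) * P.det ^ (-(1 : ℝ) / 2)) *
        (Real.exp (((a - b) ⬝ᵥ (a - b)) / (2 * ε)) *
      Real.exp (-(1 / 2 : ℝ) * ((x - b) ⬝ᵥ (P⁻¹ *ᵥ (x - b)))))) := by gcongr
    _ = _ := by ring

lemma spec_bound {D : ℕ} (M : Matrix (Fin D) (Fin D) ℝ) {ε : ℝ} (h : specNorm M ≤ ε)
    (v : Fin D → ℝ) : |v ⬝ᵥ (M *ᵥ v)| ≤ ε * (v ⬝ᵥ v) := by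
  have h1 := abs_real_inner_le_norm (WithLp.toLp 2 v : EuclideanSpace ℝ (Fin D))
    (LinearMap.toContinuousLinearMap (Matrix.toEuclideanLin M) (WithLp.toLp 2 v))
  have h2 := (LinearMap.toContinuousLinearMap (Matrix.toEuclideanLin M)).le_of_opNorm_le h
    (WithLp.toLp 2 v)
  have h3 : v ⬝ᵥ v = ‖(WithLp.toLp 2 v : EuclideanSpace ℝ (Fin D))‖ ^ 2 := by
    rw [← real_inner_self_eq_norm_sq, EuclideanSpace.inner_eq_star_dotProduct]; simp
  rw [EuclideanSpace.inner_eq_star_dotProduct] at h1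
  simp only [LinearMap.coe_toContinuousLinearMap', star_trivial, ofLp_toEuclideanLin_apply] at h1 h2
  rw [dotProduct_comm] at h1
  rw [h3]
  nlinarith [norm_nonneg (WithLp.toLp 2 v : EuclideanSpace ℝ (Fin D))]

lemma eig_bound {D : ℕ} {S : Matrix (Fin D) (Fin D) ℝ} (hS : S.IsHermitian) {lm : ℝ}
    (hev : ∀ i, lm ≤ hS.eigenvalues i) (v : Fin D → ℝ) :
    lm * (v ⬝ᵥ v) ≤ v ⬝ᵥ (S *ᵥ v) := by
  have hps : (S - algebraMap ℝ (Matrix (Fin D) (Fin D) ℝ) lm).PosSemidef := by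
    rw [posSemidef_iff_isHermitian_and_spectrum_nonneg]
    refine ⟨hS.sub ?_, ?_⟩
    · rw [Algebra.algebraMap_eq_smul_one]
      simp [Matrix.IsHermitian]
    · rw [← spectrum.sub_singleton_eq, hS.spectrum_real_eq_range_eigenvalues]
      rintro _ ⟨_, ⟨i, rfl⟩, _, rfl, rfl⟩
      have := hev i
      simpa using this
  have := hps.dotProduct_mulVec_nonneg v
  rw [Algebra.algebraMap_eq_smul_one] at this
  simp only [star_trivial, sub_mulVec, dotProduct_sub, smul_mulVec, one_mulVec, dotProduct_smul,
    smul_eq_mul] at this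
  linarith

/-- Ratio bounds `max{l/f, f/u} ≤ (1+2α)^{-D/2} exp(‖υ-υ̃‖²/(2ε))` for the Gaussian brackets. -/
theorem gaussian_bracket_ratio_bound
    (D : ℕ) (hD : 0 < D) (lm ε α : ℝ) (hlm : 0 < lm) (hε0 : 0 < ε) (hε : ε < lm / 3)
    (hα : α = 3 * ε / lm)
    (S : Matrix (Fin D) (Fin D) ℝ) (hS : S.PosDef)
    (hev : ∀ h : S.IsHermitian, ∀ i, lm ≤ h.eigenvalues i)
    (St : Matrix (Fin D) (Fin D) ℝ) (hSt : St.IsHermitian)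
    (hnear : specNorm (S - St) ≤ ε)
    (υ υt : Fin D → ℝ) :
    ∀ x : Fin D → ℝ,
      max (((1 + 2 * α) ^ (-(D : ℝ)) * gaussianPdf D υt ((1 + α)⁻¹ • St) x) /
            gaussianPdf D υ S x)
          (gaussianPdf D υ S x /
            ((1 + 2 * α) ^ ((D : ℝ)) * gaussianPdf D υt ((1 + α) • St) x)) ≤
        (1 + 2 * α) ^ (-(D : ℝ) / 2) *
          Real.exp (((υ - υt) ⬝ᵥ (υ - υt)) / (2 * ε)) := by
  intro x
  have hαε : α * lm = 3 * ε := by rw [hα]; field_simp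
  have hα0 : 0 < α := by rw [hα]; positivity
  have hα1 : α < 1 := by nlinarith
  have q1 : ∀ v, lm * (v ⬝ᵥ v) ≤ v ⬝ᵥ (S *ᵥ v) := eig_bound hS.1 (hev hS.1)
  have q2 : ∀ v, |v ⬝ᵥ (S *ᵥ v) - v ⬝ᵥ (St *ᵥ v)| ≤ ε * (v ⬝ᵥ v) := by
    intro v
    have := spec_bound _ hnear v
    rwa [sub_mulVec, dotProduct_sub] at this
  have q0 : ∀ v : Fin D → ℝ, 0 ≤ v ⬝ᵥ v := by
    intro v; simpa using dotProduct_star_self_nonneg v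
  have q0' : ∀ v : Fin D → ℝ, v ≠ 0 → 0 < v ⬝ᵥ v := by
    intro v hv; simpa using dotProduct_star_self_pos_iff.2 hv
  have q3 : ∀ v, 3 * ε * (v ⬝ᵥ v) ≤ α * (v ⬝ᵥ (S *ᵥ v)) := by
    intro v
    have := mul_le_mul_of_nonneg_left (q1 v) hα0.le
    rw [← hαε]; linarith
  have hStp : St.PosDef := by
    refine PosDef.of_dotProduct_mulVec_pos hSt ?_
    intro v hv
    have h1 := q1 v
    have h2 := abs_le.1 (q2 v)
    have h3 := q0' v hv
    rw [star_trivial]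
    nlinarith [h2.2]
  have hc : 0 < 1 + 2 * α := by linarith
  have h1α : 0 < 1 + α := by linarith
  have hcan : (1 + α) * (1 + α)⁻¹ = 1 := mul_inv_cancel₀ h1α.ne'
  apply max_le
  · have := ratio_aux (P := S) (Q := (1 + α)⁻¹ • St) hS (hStp.smul (inv_pos.2 h1α)) hε0 hc ?_ ?_
      υt υ x
    · have e : (υt - υ) ⬝ᵥ (υt - υ) = (υ - υt) ⬝ᵥ (υ - υt) := by
        rw [← neg_sub υ υt, neg_dotProduct_neg]
      rwa [e] at this
    · intro v
      rw [smul_mulVec, dotProduct_smul, smul_eq_mul]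
      obtain ⟨h2, h2'⟩ := abs_le.1 (q2 v)
      have h3 := q3 v
      have h0 := q0 v
      rw [← sub_nonneg]
      have : v ⬝ᵥ (S *ᵥ v) - ((1 + α)⁻¹ * (v ⬝ᵥ (St *ᵥ v)) + ε * (v ⬝ᵥ v)) =
        (1 + α)⁻¹ * ((1 + α) * (v ⬝ᵥ (S *ᵥ v)) - v ⬝ᵥ (St *ᵥ v) - (1 + α) * (ε * (v ⬝ᵥ v))) := by
        field_simp
        ring
      rw [this]
      apply mul_nonneg (inv_pos.2 h1α).le
      nlinarith [mul_nonneg hε0.le h0]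
    · intro v
      rw [smul_mulVec, dotProduct_smul, smul_eq_mul]
      obtain ⟨h2, h2'⟩ := abs_le.1 (q2 v)
      have h3 := q3 v
      have h0 := mul_nonneg hε0.le (q0 v)
      rw [← sub_nonneg]
      have : (1 + 2 * α) * ((1 + α)⁻¹ * (v ⬝ᵥ (St *ᵥ v))) - v ⬝ᵥ (S *ᵥ v) =
        (1 + α)⁻¹ * ((1 + 2 * α) * (v ⬝ᵥ (St *ᵥ v)) - (1 + α) * (v ⬝ᵥ (S *ᵥ v))) := by
        field_simp
      rw [this]
      apply mul_nonneg (inv_pos.2 h1α).le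
      nlinarith [mul_nonneg (sub_nonneg.2 hα1.le) h0]
  · have := ratio_aux (P := (1 + α) • St) (Q := S) (hStp.smul h1α) hS hε0 hc ?_ ?_
      υ υt x
    · rw [Real.rpow_neg hc.le] at this
      refine le_trans (le_of_eq ?_) this
      rw [div_mul_eq_div_div, div_eq_mul_inv (gaussianPdf D υ S x), mul_comm (gaussianPdf D υ S x)]
    · intro v
      rw [smul_mulVec, dotProduct_smul, smul_eq_mul]
      obtain ⟨h2, h2'⟩ := abs_le.1 (q2 v)
      have h3 := q3 v
      have h0 := mul_nonneg hε0.le (q0 v)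
      nlinarith [mul_nonneg (sub_nonneg.2 hα1.le) h0]
    · intro v
      rw [smul_mulVec, dotProduct_smul, smul_eq_mul]
      obtain ⟨h2, h2'⟩ := abs_le.1 (q2 v)
      have h3 := q3 v
      have h0 := mul_nonneg hε0.le (q0 v)
      nlinarith [mul_nonneg (sub_nonneg.2 hα1.le) h0]
end

section
/- Let D be a positive integer, λ_m > 0, 0 < ε < λ_m/3, and α = 3ε/λ_m. Let Σ be a D×D symmetric positive definite matrix with smallest eigenvalue at least λ_m, and Σ̃ a D×D symmetric matrix with ‖Σ − Σ̃‖₂ ≤ ε in spectral norm. Let υ, υ̃ ∈ ℝ^D satisfy ‖υ − υ̃‖₂² ≤ D α ε. Define f(x) = Φ_D(x; υ, Σ), l(x) = (1+2α)^{−D} Φ_D(x; υ̃, (1+α)⁻¹Σ̃), u(x) = (1+2α)^{D} Φ_D(x; υ̃, (1+α)Σ̃). Then l(x) ≤ f(x) ≤ u(x) for all x ∈ ℝ^D; that is, [l, u] is a bracket containing f. -/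
open Matrix

theorem gb_eigen_one_le {D : ℕ} (M : Matrix (Fin D) (Fin D) ℝ) (hM : (M - 1).PosSemidef) :
    1 ≤ M.det := by
  have hH : M.IsHermitian := by
    have := hM.1.add (isHermitian_one (n := Fin D) (α := ℝ))
    simpa using this
  rw [hH.det_eq_prod_eigenvalues]
  have : ∀ i, 1 ≤ hH.eigenvalues i := by
    intro i
    have h1 := hM.dotProduct_mulVec_nonneg (hH.eigenvectorBasis i).ofLp
    rw [sub_mulVec, hH.mulVec_eigenvectorBasis, one_mulVec, dotProduct_sub, dotProduct_smul] at h1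
    have h2 : star (hH.eigenvectorBasis i).ofLp ⬝ᵥ (hH.eigenvectorBasis i).ofLp = (1:ℝ) := by
      have := hH.eigenvectorBasis.orthonormal.1 i
      have h3 := real_inner_self_eq_norm_sq (hH.eigenvectorBasis i)
      rw [this, EuclideanSpace.inner_eq_star_dotProduct] at h3
      simpa [dotProduct_comm] using h3
    rw [h2] at h1
    simp at h1
    linarith
  simpa using Finset.prod_le_prod (s := Finset.univ) (f := fun _ => (1:ℝ)) (by simp)
    (fun i _ => this i)

theorem gb_det_mono {D : ℕ} (P Q : Matrix (Fin D) (Fin D) ℝ) (hP : P.PosDef)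
    (h : (Q - P).PosSemidef) : P.det ≤ Q.det := by
  obtain ⟨W, hW⟩ : ∃ W : Matrix (Fin D) (Fin D) ℝ, P = Wᴴ * W := by
    open scoped MatrixOrder in
    exact CStarAlgebra.nonneg_iff_eq_star_mul_self.mp hP.posSemidef.nonneg
  have hdet : P.det = W.det * W.det := by rw [hW]; simp
  have hpos := hP.det_pos
  have hWu : IsUnit W.det := by
    rw [isUnit_iff_ne_zero]; rintro h0; rw [h0] at hdet; simp [hdet] at hpos
  have hWu' : IsUnit Wᴴ.det := by simpa using hWu
  have h1 := h.conjTranspose_mul_mul_same W⁻¹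
  have h2 : W⁻¹ᴴ * (Q - P) * W⁻¹ = W⁻¹ᴴ * Q * W⁻¹ - 1 := by
    rw [mul_sub, sub_mul, hW, conjTranspose_nonsing_inv]
    congr 1
    rw [← mul_assoc, nonsing_inv_mul _ hWu', one_mul, mul_nonsing_inv _ hWu]
  rw [h2] at h1
  have h3 := gb_eigen_one_le _ h1
  have h4 : Q.det = P.det * (W⁻¹ᴴ * Q * W⁻¹).det := by
    have hne := hWu.ne_zero
    simp [hdet, det_nonsing_inv]
    field_simp
  rw [h4]
  nlinarith

theorem gb_quad {D : ℕ} (P Q : Matrix (Fin D) (Fin D) ℝ) (hP : P.PosDef) (hQ : Q.PosDef) (ε : ℝ)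
    (hε : 0 < ε) (h : (Q - P - ε • (1 : Matrix (Fin D) (Fin D) ℝ)).PosSemidef)
    (y δ : Fin D → ℝ) :
    (y + δ) ⬝ᵥ (Q⁻¹ *ᵥ (y + δ)) ≤ y ⬝ᵥ (P⁻¹ *ᵥ y) + (δ ⬝ᵥ δ) / ε := by
  set z := y + δ with hz
  set w := Q⁻¹ *ᵥ z with hw
  have hQw : Q *ᵥ w = z := by
    rw [hw, mulVec_mulVec, mul_nonsing_inv _ (isUnit_iff_ne_zero.2 hQ.det_pos.ne'), one_mulVec]
  have hPu := isUnit_iff_ne_zero.2 hP.det_pos.ne'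
  have h1 := h.dotProduct_mulVec_nonneg w
  have h2 := hP.inv.posSemidef.dotProduct_mulVec_nonneg (y - P *ᵥ w)
  have h3 : 0 ≤ (δ - ε • w) ⬝ᵥ (δ - ε • w) := by
    simpa using dotProduct_star_self_nonneg (δ - ε • w)
  have hsym : (P *ᵥ w) ⬝ᵥ (P⁻¹ *ᵥ y) = w ⬝ᵥ y := by
    rw [dotProduct_mulVec, ← mulVec_transpose, mulVec_mulVec]
    have : P⁻¹ᵀ = P⁻¹ := by
      have h0 := hP.inv.1
      rwa [IsHermitian, conjTranspose_eq_transpose_of_trivial] at h0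
    rw [this, nonsing_inv_mul _ hPu, one_mulVec]
  simp only [sub_mulVec, hQw, smul_mulVec, one_mulVec, star_trivial, dotProduct_sub,
    dotProduct_smul, smul_eq_mul] at h1
  rw [star_trivial, mulVec_sub, mulVec_mulVec w P⁻¹ P, nonsing_inv_mul _ hPu, one_mulVec,
    sub_dotProduct, dotProduct_sub, dotProduct_sub, hsym, dotProduct_comm y w,
    dotProduct_comm (P *ᵥ w) w] at h2
  simp only [sub_dotProduct, dotProduct_sub, smul_dotProduct, dotProduct_smul, smul_eq_mul,
    dotProduct_comm w δ] at h3
  have h4 : 2 * (δ ⬝ᵥ w) ≤ (δ ⬝ᵥ δ) / ε + ε * (w ⬝ᵥ w) := by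
    rw [← sub_nonneg]
    have : (δ ⬝ᵥ δ) / ε + ε * (w ⬝ᵥ w) - 2 * (δ ⬝ᵥ w) =
      (δ ⬝ᵥ δ - ε * δ ⬝ᵥ w - ε * (δ ⬝ᵥ w - ε * w ⬝ᵥ w)) / ε := by field_simp; ring
    rw [this]; positivity
  have h5 : z ⬝ᵥ w = w ⬝ᵥ z := dotProduct_comm _ _
  have h6 : w ⬝ᵥ z = w ⬝ᵥ y + δ ⬝ᵥ w := by rw [hz, dotProduct_add, dotProduct_comm w δ]
  linarith

theorem gb_main {D : ℕ} (P Q : Matrix (Fin D) (Fin D) ℝ) (hP : P.PosDef) (hQ : Q.PosDef) (ε α k : ℝ)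
    (hε : 0 < ε) (hk0 : 0 < k) (hk : Real.exp α ≤ k)
    (h : (Q - P - ε • (1 : Matrix (Fin D) (Fin D) ℝ)).PosSemidef)
    (h' : (k • P - Q).PosSemidef)
    (a b : Fin D → ℝ) (hab : (a - b) ⬝ᵥ (a - b) ≤ D * α * ε) (x : Fin D → ℝ) :
    gaussianPdf D a P x ≤ k ^ (D : ℝ) * gaussianPdf D b Q x := by
  have hq := gb_quad P Q hP hQ ε hε h (x - a) (a - b)
  rw [sub_add_sub_cancel] at hq
  have hd := gb_det_mono Q (k • P) hQ h'
  rw [det_smul, Fintype.card_fin, ← Real.rpow_natCast] at hd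
  have hPd := hP.det_pos
  have hQd := hQ.det_pos
  have hab' : (a - b) ⬝ᵥ (a - b) / ε ≤ D * α := by rwa [div_le_iff₀ hε]
  have hdet : P.det ^ (-(1:ℝ)/2) ≤ k ^ ((D:ℝ)/2) * Q.det ^ (-(1:ℝ)/2) := by
    have h1 := Real.rpow_le_rpow_of_nonpos hQd hd (z := -(1:ℝ)/2) (by norm_num)
    rw [Real.mul_rpow (by positivity) hPd.le, ← Real.rpow_mul hk0.le] at h1
    calc P.det ^ (-(1:ℝ)/2)
        = k ^ ((D:ℝ)/2) * (k ^ ((D:ℝ) * (-(1:ℝ)/2)) * P.det ^ (-(1:ℝ)/2)) := by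
          rw [← mul_assoc, ← Real.rpow_add hk0]
          ring_nf; simp
      _ ≤ _ := by gcongr
  have hexp : Real.exp (-(1 / 2 : ℝ) * ((x - a) ⬝ᵥ (P⁻¹ *ᵥ (x - a)))) ≤
      k ^ ((D:ℝ)/2) * Real.exp (-(1 / 2 : ℝ) * ((x - b) ⬝ᵥ (Q⁻¹ *ᵥ (x - b)))) := by
    calc _ ≤ Real.exp (α * ((D:ℝ)/2) + -(1 / 2 : ℝ) * ((x - b) ⬝ᵥ (Q⁻¹ *ᵥ (x - b)))) := by
          apply Real.exp_le_exp.2; linarith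
      _ = (Real.exp α) ^ ((D:ℝ)/2) * _ := by rw [Real.exp_add, Real.exp_mul]
      _ ≤ _ := by gcongr
  unfold gaussianPdf
  calc _ ≤ (2 * Real.pi) ^ (-(D : ℝ) / 2) * (k ^ ((D:ℝ)/2) * Q.det ^ (-(1:ℝ)/2)) *
        (k ^ ((D:ℝ)/2) * Real.exp (-(1 / 2 : ℝ) * ((x - b) ⬝ᵥ (Q⁻¹ *ᵥ (x - b))))) := by
        gcongr
    _ = (k ^ ((D:ℝ)/2) * k ^ ((D:ℝ)/2)) * ((2 * Real.pi) ^ (-(D : ℝ) / 2) * Q.det ^ (-(1:ℝ)/2) *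
        Real.exp (-(1 / 2 : ℝ) * ((x - b) ⬝ᵥ (Q⁻¹ *ᵥ (x - b))))) := by ring
    _ = _ := by rw [← Real.rpow_add hk0, add_halves]

theorem gb_exp (α : ℝ) (h0 : 0 ≤ α) (h1 : α ≤ 1) : Real.exp α ≤ 1 + 2 * α := by
  have h := Real.abs_exp_sub_one_sub_id_le (x := α) (by rw [abs_of_nonneg h0]; exact h1)
  have := (abs_le.1 h).2
  nlinarith

theorem gb_lower {D : ℕ} (S : Matrix (Fin D) (Fin D) ℝ) (lm : ℝ) (hS : S.IsHermitian)
    (hev : ∀ i, lm ≤ hS.eigenvalues i) :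
    (S - lm • (1 : Matrix (Fin D) (Fin D) ℝ)).PosSemidef := by
  rw [posSemidef_iff_isHermitian_and_spectrum_nonneg]
  refine ⟨hS.sub (by simp [IsHermitian]), ?_⟩
  intro μ hμ
  have : μ + lm ∈ spectrum ℝ S := by
    rw [spectrum.add_mem_iff]
    have h2 : S - lm • (1 : Matrix (Fin D) (Fin D) ℝ) = -(algebraMap ℝ _ lm) + S := by
      rw [Algebra.algebraMap_eq_smul_one]; abel
    rwa [h2] at hμ
  rw [hS.spectrum_real_eq_range_eigenvalues] at this
  obtain ⟨i, hi⟩ := this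
  have := hev i
  simp only [Set.mem_setOf_eq]
  linarith

theorem gb_norm {D : ℕ} (M : Matrix (Fin D) (Fin D) ℝ) (ε : ℝ) (h : specNorm M ≤ ε)
    (w : Fin D → ℝ) : |w ⬝ᵥ (M *ᵥ w)| ≤ ε * (w ⬝ᵥ w) := by
  set T := LinearMap.toContinuousLinearMap (Matrix.toEuclideanLin M) with hT
  set v : EuclideanSpace ℝ (Fin D) := WithLp.toLp 2 w with hv
  have h1 : inner ℝ v (T v) = w ⬝ᵥ (M *ᵥ w) := by
    rw [EuclideanSpace.inner_eq_star_dotProduct]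
    simp [hT, hv, dotProduct_comm]
  have h2 : ‖v‖ * ‖v‖ = w ⬝ᵥ w := by
    rw [← real_inner_self_eq_norm_mul_norm, EuclideanSpace.inner_eq_star_dotProduct]
    simp [hv]
  rw [← h1, ← h2]
  calc _ ≤ ‖v‖ * ‖T v‖ := abs_real_inner_le_norm _ _
    _ ≤ ‖v‖ * (ε * ‖v‖) := by
      gcongr
      exact T.le_of_opNorm_le h v
    _ = _ := by ring

/-- The pair `[l, u]` is a bracket containing the Gaussian density `f`. -/
theorem gaussian_bracket_containment
    (D : ℕ) (hD : 0 < D) (lm ε α : ℝ) (hlm : 0 < lm) (hε0 : 0 < ε) (hε : ε < lm / 3)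
    (hα : α = 3 * ε / lm)
    (S : Matrix (Fin D) (Fin D) ℝ) (hS : S.PosDef)
    (hev : ∀ h : S.IsHermitian, ∀ i, lm ≤ h.eigenvalues i)
    (St : Matrix (Fin D) (Fin D) ℝ) (hSt : St.IsHermitian)
    (hnear : specNorm (S - St) ≤ ε)
    (υ υt : Fin D → ℝ) (hmean : (υ - υt) ⬝ᵥ (υ - υt) ≤ D * α * ε) :
    ∀ x : Fin D → ℝ,
      (1 + 2 * α) ^ (-(D : ℝ)) * gaussianPdf D υt ((1 + α)⁻¹ • St) x ≤
          gaussianPdf D υ S x ∧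
      gaussianPdf D υ S x ≤
          (1 + 2 * α) ^ ((D : ℝ)) * gaussianPdf D υt ((1 + α) • St) x := by
  have hα0 : 0 < α := by rw [hα]; positivity
  have hα1 : α < 1 := by rw [hα, div_lt_one hlm]; linarith
  have hαl : α * lm = 3 * ε := by rw [hα]; field_simp
  have hlow : ∀ w, lm * (w ⬝ᵥ w) ≤ w ⬝ᵥ (S *ᵥ w) := by
    intro w
    have := (gb_lower S lm hS.1 (hev hS.1)).dotProduct_mulVec_nonneg w
    simp only [sub_mulVec, smul_mulVec, one_mulVec, star_trivial, dotProduct_sub,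
      dotProduct_smul, smul_eq_mul] at this
    linarith
  have hd : ∀ w, |w ⬝ᵥ (S *ᵥ w) - w ⬝ᵥ (St *ᵥ w)| ≤ ε * (w ⬝ᵥ w) := by
    intro w
    have := gb_norm _ ε hnear w
    rwa [sub_mulVec, dotProduct_sub] at this
  have hw0 : ∀ w : Fin D → ℝ, 0 ≤ w ⬝ᵥ w := fun w => by
    simpa using dotProduct_star_self_nonneg w
  -- every combination with nonnegative quadratic form is positive semidefinite
  have key : ∀ c d e : ℝ, (∀ w : Fin D → ℝ, 0 ≤ c * (w ⬝ᵥ (S *ᵥ w)) + d * (w ⬝ᵥ (St *ᵥ w))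
      + e * (w ⬝ᵥ w)) → (c • S + d • St + e • (1 : Matrix (Fin D) (Fin D) ℝ)).PosSemidef := by
    intro c d e h
    have hSh := hS.1
    refine PosSemidef.of_dotProduct_mulVec_nonneg ?_ ?_
    · unfold IsHermitian at *
      simp [hSh, hSt, -conjTranspose_eq_transpose_of_trivial]
    · intro w
      simpa [add_mulVec, smul_mulVec, dotProduct_add, dotProduct_smul] using h w
  have hStP : St.PosDef := by
    refine PosDef.of_dotProduct_mulVec_pos hSt ?_
    intro w hw
    have h1 : 0 < w ⬝ᵥ w := by
      simpa using (dotProduct_star_self_pos_iff (v := w)).2 hw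
    have h2 := (abs_le.1 (hd w)).2
    have h3 := hlow w
    rw [star_trivial]
    nlinarith
  have hk := gb_exp α hα0.le hα1.le
  have hk0 : 0 < 1 + 2 * α := by linarith
  have hi0 : 0 < (1 + α)⁻¹ := by positivity
  have hi1 : (1 + α)⁻¹ * (1 + α) = 1 := inv_mul_cancel₀ (by positivity)
  intro x
  constructor
  · rw [Real.rpow_neg hk0.le, inv_mul_le_iff₀ (by positivity)]
    refine gb_main ((1 + α)⁻¹ • St) S (hStP.smul hi0) hS ε α _ hε0 hk0 hk ?_ ?_ υt υ ?_ x
    · have := key 1 (-(1 + α)⁻¹) (-ε) ?_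
      · convert this using 1
        module
      · intro w
        have h2 := (abs_le.1 (hd w)).1
        have h3 := mul_le_mul_of_nonneg_left (hlow w) hα0.le
        have h4 := hw0 w
        set s := w ⬝ᵥ (S *ᵥ w)
        set t := w ⬝ᵥ (St *ᵥ w)
        set n := w ⬝ᵥ w
        have : 1 * s + -(1 + α)⁻¹ * t + -ε * n = (1 + α)⁻¹ * ((1 + α) * s - t - (1 + α) * ε * n) := by
          field_simp
          ring
        rw [this]
        apply mul_nonneg hi0.le
        have h5 : α * ε * n ≤ 1 * (ε * n) := by
          rw [mul_assoc]; gcongr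
        rw [← mul_assoc, hαl] at h3
        linarith
    · have := key (-1) ((1 + 2 * α) * (1 + α)⁻¹) 0 ?_
      · convert this using 1
        module
      · intro w
        have h2 := (abs_le.1 (hd w)).2
        have h3 := mul_le_mul_of_nonneg_left (hlow w) hα0.le
        have h4 := hw0 w
        set s := w ⬝ᵥ (S *ᵥ w)
        set t := w ⬝ᵥ (St *ᵥ w)
        set n := w ⬝ᵥ w
        have : -1 * s + (1 + 2 * α) * (1 + α)⁻¹ * t + 0 * n
            = (1 + α)⁻¹ * ((1 + 2 * α) * t - (1 + α) * s) := by
          field_simp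
          ring
        rw [this]
        apply mul_nonneg hi0.le
        have h5 : α * ε * n ≤ 1 * (ε * n) := by
          rw [mul_assoc]; gcongr
        rw [← mul_assoc, hαl] at h3
        have h6 := mul_le_mul_of_nonneg_left h2 hk0.le
        nlinarith
    · rw [← neg_sub υ υt, neg_dotProduct_neg]
      exact hmean
  · refine gb_main S ((1 + α) • St) hS (hStP.smul (by positivity)) ε α _ hε0 hk0 hk ?_ ?_ υ υt hmean x
    · have := key (-1) (1 + α) (-ε) ?_
      · convert this using 1
        module
      · intro w
        have h2 := (abs_le.1 (hd w)).2
        have h3 := mul_le_mul_of_nonneg_left (hlow w) hα0.le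
        have h4 := hw0 w
        have h5 : α * ε * (w ⬝ᵥ w) ≤ 1 * (ε * (w ⬝ᵥ w)) := by
          rw [mul_assoc]; gcongr
        rw [← mul_assoc, hαl] at h3
        have h6 := mul_le_mul_of_nonneg_left h2 (by positivity : 0 ≤ 1 + α)
        nlinarith
    · have := key (1 + 2 * α) (-(1 + α)) 0 ?_
      · convert this using 1
        module
      · intro w
        have h2 := (abs_le.1 (hd w)).1
        have h3 := mul_le_mul_of_nonneg_left (hlow w) hα0.le
        have h4 := hw0 w
        have h5 : α * ε * (w ⬝ᵥ w) ≤ 1 * (ε * (w ⬝ᵥ w)) := by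
          rw [mul_assoc]; gcongr
        rw [← mul_assoc, hαl] at h3
        have h6 := mul_le_mul_of_nonneg_left h2 (by positivity : 0 ≤ 1 + α)
        have h7 : 0 ≤ ε * (w ⬝ᵥ w) := by positivity
        nlinarith
end

section
/- Let D be a positive integer, α > 0, μ ∈ ℝ^D, and Σ̃ a D×D symmetric positive definite real matrix. Define l(x) = (1+2α)^{−D} Φ_D(x; μ, (1+α)⁻¹Σ̃) and u(x) = (1+2α)^{D} Φ_D(x; μ, (1+α)Σ̃). Then ∫_{ℝ^D} ( l(x) + u(x) − 2√(l(x)u(x)) ) dx = 2( cosh(D ln(1+2α)) − 1 ) + 2( 1 − (cosh(ln(1+α)))^{−D/2} ). In particular the squared Hellinger-type size of the bracket [l, u], namely ∫(√u − √l)² dx, equals 2 cosh(D ln(1+2α)) − 2 + 2(1 − (cosh(ln(1+α)))^{−D/2}). -/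
open Matrix MeasureTheory

lemma gaussian_std_integral (d : ℕ) :
    ∫ y : Fin d → ℝ, Real.exp (-(1 / 2 : ℝ) * (y ⬝ᵥ y)) = (2 * Real.pi) ^ ((d : ℝ) / 2) := by
  have h : ∀ y : Fin d → ℝ, Real.exp (-(1 / 2 : ℝ) * (y ⬝ᵥ y))
      = ∏ i, Real.exp (-(1 / 2 : ℝ) * (y i) ^ 2) := by
    intro y
    rw [← Real.exp_sum, ← Finset.mul_sum]
    simp [dotProduct, pow_two]
  simp_rw [h]
  rw [integral_fintype_prod_volume_eq_prod (fun (_ : Fin d) (t : ℝ) => Real.exp (-(1 / 2 : ℝ) * t ^ 2))]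
  rw [Finset.prod_const, integral_gaussian, Finset.card_univ, Fintype.card_fin]
  rw [Real.sqrt_eq_rpow, ← Real.rpow_natCast, ← Real.rpow_mul (by positivity)]
  congr 1
  · ring
  · ring

open scoped MatrixOrder in
lemma gaussianPdf_integral (d : ℕ) (μ : Fin d → ℝ) (S : Matrix (Fin d) (Fin d) ℝ)
    (hS : S.PosDef) : ∫ x, gaussianPdf d μ S x = 1 := by
  have hdet := hS.det_pos
  obtain ⟨B, hB⟩ := CStarAlgebra.nonneg_iff_eq_star_mul_self.mp hS.inv.posSemidef.nonneg
  rw [Matrix.star_eq_conjTranspose, Matrix.conjTranspose_eq_transpose_of_trivial] at hB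
  have hq : ∀ v : Fin d → ℝ, v ⬝ᵥ (S⁻¹ *ᵥ v) = (B *ᵥ v) ⬝ᵥ (B *ᵥ v) := by
    intro v
    rw [hB, ← Matrix.mulVec_mulVec, Matrix.dotProduct_mulVec, Matrix.vecMul_transpose]
  have hBd : B.det * B.det = S.det⁻¹ := by
    have := congrArg Matrix.det hB
    rw [Matrix.det_mul, Matrix.det_transpose, Matrix.det_nonsing_inv, Ring.inverse_eq_inv'] at this
    exact this.symm
  have hB0 : B.det ≠ 0 := by
    intro h
    rw [h] at hBd
    have := inv_pos.mpr hdet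
    linarith
  have hpi : 0 < 2 * Real.pi := by positivity
  have habs : |B.det| = S.det ^ (-(1 : ℝ) / 2) := by
    rw [← Real.sqrt_mul_self_eq_abs, hBd, Real.sqrt_eq_rpow, ← Real.rpow_neg_one,
      ← Real.rpow_mul hdet.le]
    norm_num
  have hmain : ∫ v : Fin d → ℝ, Real.exp (-(1 / 2 : ℝ) * (v ⬝ᵥ (S⁻¹ *ᵥ v)))
      = |B.det|⁻¹ * (2 * Real.pi) ^ ((d : ℝ) / 2) := by
    rw [← gaussian_std_integral]
    have hmap := Real.map_matrix_volume_pi_eq_smul_volume_pi hB0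
    have hm : Measurable (Matrix.toLin' B) :=
      (LinearMap.continuous_of_finiteDimensional _).measurable
    have := integral_map (μ := volume) hm.aemeasurable
      (f := fun y : Fin d → ℝ => Real.exp (-(1 / 2 : ℝ) * (y ⬝ᵥ y)))
      (Continuous.aestronglyMeasurable (by unfold dotProduct; fun_prop))
    rw [hmap, integral_smul_measure, ENNReal.toReal_ofReal (abs_nonneg _), abs_inv] at this
    simp only [hq]
    simpa using this.symm
  simp only [gaussianPdf]
  rw [integral_const_mul,
    integral_sub_right_eq_self (fun v : Fin d → ℝ => Real.exp (-(1 / 2 : ℝ) * (v ⬝ᵥ (S⁻¹ *ᵥ v)))) μ,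
    hmain, ← habs]
  have h1 : (2 * Real.pi) ^ (-(d : ℝ) / 2) * (2 * Real.pi) ^ ((d : ℝ) / 2) = 1 := by
    rw [← Real.rpow_add hpi]
    ring_nf
    simp
  have h2 : |B.det| ≠ 0 := abs_ne_zero.mpr hB0
  calc _ = ((2 * Real.pi) ^ (-(d : ℝ) / 2) * (2 * Real.pi) ^ ((d : ℝ) / 2))
        * (|B.det| * |B.det|⁻¹) := by ring
    _ = 1 := by rw [h1, mul_inv_cancel₀ h2, one_mul]

lemma gaussianPdf_integrable (d : ℕ) (μ : Fin d → ℝ) (S : Matrix (Fin d) (Fin d) ℝ)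
    (hS : S.PosDef) : Integrable (fun x => gaussianPdf d μ S x) := by
  by_contra h
  have h1 := gaussianPdf_integral d μ S hS
  rw [integral_undef h] at h1
  norm_num at h1

lemma gaussianPdf_nonneg (d : ℕ) (μ : Fin d → ℝ) (S : Matrix (Fin d) (Fin d) ℝ)
    (hS : S.PosDef) (x : Fin d → ℝ) : 0 ≤ gaussianPdf d μ S x := by
  have := hS.det_pos
  unfold gaussianPdf
  positivity

lemma gaussianPdf_smul (d : ℕ) (μ : Fin d → ℝ) (S : Matrix (Fin d) (Fin d) ℝ)
    (hS : S.PosDef) (a : ℝ) (ha : 0 < a) (x : Fin d → ℝ) :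
    gaussianPdf d μ (a • S) x = (2 * Real.pi) ^ (-(d : ℝ) / 2) * S.det ^ (-(1 : ℝ) / 2) *
      a ^ (-(d : ℝ) / 2) * Real.exp (-(1 / 2 : ℝ) * a⁻¹ * ((x - μ) ⬝ᵥ (S⁻¹ *ᵥ (x - μ)))) := by
  have hdet := hS.det_pos
  have hu : IsUnit S.det := hdet.ne'.isUnit
  have hinv : (a • S)⁻¹ = a⁻¹ • S⁻¹ := by
    apply Matrix.inv_eq_left_inv
    rw [Matrix.smul_mul, Matrix.mul_smul, Matrix.nonsing_inv_mul _ hu, smul_smul,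
      inv_mul_cancel₀ ha.ne', one_smul]
  unfold gaussianPdf
  rw [hinv, Matrix.det_smul, Fintype.card_fin, Real.mul_rpow (by positivity) hdet.le,
    Matrix.smul_mulVec, dotProduct_smul, smul_eq_mul, ← Real.rpow_natCast,
    ← Real.rpow_mul ha.le]
  rw [show (d : ℝ) * (-1 / 2) = -(d : ℝ) / 2 by ring]
  rw [← mul_assoc (-(1 / 2 : ℝ))]
  ring

lemma gaussianPdf_sqrt (d : ℕ) (μ : Fin d → ℝ) (S : Matrix (Fin d) (Fin d) ℝ)
    (hS : S.PosDef) (a : ℝ) (ha : 0 < a) (x : Fin d → ℝ) :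
    Real.sqrt (gaussianPdf d μ (a⁻¹ • S) x * gaussianPdf d μ (a • S) x) =
      (Real.cosh (Real.log a)) ^ (-(d : ℝ) / 2) *
        gaussianPdf d μ ((Real.cosh (Real.log a))⁻¹ • S) x := by
  have hc : 0 < Real.cosh (Real.log a) := Real.cosh_pos _
  have hdet := hS.det_pos
  rw [gaussianPdf_smul d μ S hS _ (inv_pos.mpr ha), gaussianPdf_smul d μ S hS _ ha,
    gaussianPdf_smul d μ S hS _ (inv_pos.mpr hc)]
  have h1 : ∀ b : ℝ, 0 < b → b ^ (-(d : ℝ) / 2) * (b⁻¹) ^ (-(d : ℝ) / 2) = 1 := by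
    intro b hb
    rw [← Real.mul_rpow hb.le (inv_pos.mpr hb).le, mul_inv_cancel₀ hb.ne', Real.one_rpow]
  have ha1 := h1 a ha
  have hc1 := h1 _ hc
  rw [inv_inv, inv_inv]
  have hcosh : 2 * Real.cosh (Real.log a) = a + a⁻¹ := by
    rw [Real.cosh_log ha]; ring
  generalize (x - μ) ⬝ᵥ (S⁻¹ *ᵥ (x - μ)) = q
  generalize Real.cosh (Real.log a) = c at *
  have he : Real.exp (-(1 / 2 : ℝ) * a * q) * Real.exp (-(1 / 2 : ℝ) * a⁻¹ * q)
      = Real.exp (-(1 / 2 : ℝ) * c * q) * Real.exp (-(1 / 2 : ℝ) * c * q) := by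
    rw [← Real.exp_add, ← Real.exp_add]
    congr 1
    linear_combination (1 / 2 : ℝ) * q * hcosh
  set K := (2 * Real.pi) ^ (-(d : ℝ) / 2) * S.det ^ (-(1 : ℝ) / 2) with hK
  have hK0 : 0 ≤ K := by positivity
  rw [show c ^ (-(d : ℝ) / 2) * (K * c⁻¹ ^ (-(d : ℝ) / 2) * Real.exp (-(1 / 2 : ℝ) * c * q))
    = K * Real.exp (-(1 / 2 : ℝ) * c * q) by linear_combination (K * Real.exp (-(1 / 2 : ℝ) * c * q)) * hc1]
  rw [← Real.sqrt_mul_self (show 0 ≤ K * Real.exp (-(1 / 2 : ℝ) * c * q) by positivity)]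
  congr 1
  linear_combination (K * K * Real.exp (-(1 / 2 : ℝ) * a * q) * Real.exp (-(1 / 2 : ℝ) * a⁻¹ * q)) * ha1
    + K * K * he

/-- Exact Hellinger-type size of the Gaussian bracket `[l, u]`. -/
theorem gaussian_bracket_size_eq
    (D : ℕ) (hD : 0 < D) (α : ℝ) (hα : 0 < α) (μ : Fin D → ℝ)
    (St : Matrix (Fin D) (Fin D) ℝ) (hSt : St.PosDef) :
    (∫ x : Fin D → ℝ,
        ((1 + 2 * α) ^ (-(D : ℝ)) * gaussianPdf D μ ((1 + α)⁻¹ • St) x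
          + (1 + 2 * α) ^ ((D : ℝ)) * gaussianPdf D μ ((1 + α) • St) x
          - 2 * Real.sqrt (((1 + 2 * α) ^ (-(D : ℝ)) * gaussianPdf D μ ((1 + α)⁻¹ • St) x) *
              ((1 + 2 * α) ^ ((D : ℝ)) * gaussianPdf D μ ((1 + α) • St) x))) =
      2 * (Real.cosh ((D : ℝ) * Real.log (1 + 2 * α)) - 1)
        + 2 * (1 - (Real.cosh (Real.log (1 + α))) ^ (-(D : ℝ) / 2))) ∧
    ∫ x : Fin D → ℝ,
        (Real.sqrt ((1 + 2 * α) ^ ((D : ℝ)) * gaussianPdf D μ ((1 + α) • St) x)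
          - Real.sqrt ((1 + 2 * α) ^ (-(D : ℝ)) * gaussianPdf D μ ((1 + α)⁻¹ • St) x)) ^ 2 =
      2 * Real.cosh ((D : ℝ) * Real.log (1 + 2 * α)) - 2
        + 2 * (1 - (Real.cosh (Real.log (1 + α))) ^ (-(D : ℝ) / 2)) := by
  have ha : 0 < 1 + α := by linarith
  have hb : 0 < 1 + 2 * α := by linarith
  have hc : 0 < Real.cosh (Real.log (1 + α)) := Real.cosh_pos _
  have hl : ((1 + α)⁻¹ • St).PosDef := hSt.smul (inv_pos.mpr ha)
  have hu : ((1 + α) • St).PosDef := hSt.smul ha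
  have hm : ((Real.cosh (Real.log (1 + α)))⁻¹ • St).PosDef := hSt.smul (inv_pos.mpr hc)
  have hbb : (1 + 2 * α) ^ (-(D : ℝ)) * (1 + 2 * α) ^ ((D : ℝ)) = 1 := by
    rw [← Real.rpow_add hb]; simp
  have hcosh : 2 * Real.cosh ((D : ℝ) * Real.log (1 + 2 * α))
      = (1 + 2 * α) ^ (-(D : ℝ)) + (1 + 2 * α) ^ ((D : ℝ)) := by
    rw [Real.cosh_eq, Real.rpow_def_of_pos hb, Real.rpow_def_of_pos hb]
    ring_nf
  have hsq : ∀ x, Real.sqrt (((1 + 2 * α) ^ (-(D : ℝ)) * gaussianPdf D μ ((1 + α)⁻¹ • St) x) *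
              ((1 + 2 * α) ^ ((D : ℝ)) * gaussianPdf D μ ((1 + α) • St) x))
      = (Real.cosh (Real.log (1 + α))) ^ (-(D : ℝ) / 2) *
        gaussianPdf D μ ((Real.cosh (Real.log (1 + α)))⁻¹ • St) x := by
    intro x
    rw [← gaussianPdf_sqrt D μ St hSt _ ha, mul_mul_mul_comm, hbb, one_mul]
  have main : (∫ x : Fin D → ℝ,
        ((1 + 2 * α) ^ (-(D : ℝ)) * gaussianPdf D μ ((1 + α)⁻¹ • St) x
          + (1 + 2 * α) ^ ((D : ℝ)) * gaussianPdf D μ ((1 + α) • St) x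
          - 2 * Real.sqrt (((1 + 2 * α) ^ (-(D : ℝ)) * gaussianPdf D μ ((1 + α)⁻¹ • St) x) *
              ((1 + 2 * α) ^ ((D : ℝ)) * gaussianPdf D μ ((1 + α) • St) x))) =
      2 * (Real.cosh ((D : ℝ) * Real.log (1 + 2 * α)) - 1)
        + 2 * (1 - (Real.cosh (Real.log (1 + α))) ^ (-(D : ℝ) / 2))) := by
    simp_rw [hsq]
    have il := (gaussianPdf_integrable D μ _ hl).const_mul ((1 + 2 * α) ^ (-(D : ℝ)))
    have iu := (gaussianPdf_integrable D μ _ hu).const_mul ((1 + 2 * α) ^ ((D : ℝ)))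
    have im := ((gaussianPdf_integrable D μ _ hm).const_mul
      ((Real.cosh (Real.log (1 + α))) ^ (-(D : ℝ) / 2))).const_mul 2
    rw [integral_sub (by exact il.add iu) im, integral_add il iu]
    simp only [integral_const_mul]
    rw [gaussianPdf_integral D μ _ hl, gaussianPdf_integral D μ _ hu,
      gaussianPdf_integral D μ _ hm]
    linear_combination -hcosh
  refine ⟨main, ?_⟩
  rw [show 2 * Real.cosh ((D : ℝ) * Real.log (1 + 2 * α)) - 2
        + 2 * (1 - (Real.cosh (Real.log (1 + α))) ^ (-(D : ℝ) / 2)) =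
      2 * (Real.cosh ((D : ℝ) * Real.log (1 + 2 * α)) - 1)
        + 2 * (1 - (Real.cosh (Real.log (1 + α))) ^ (-(D : ℝ) / 2)) by ring, ← main]
  congr 1
  funext x
  have pl : 0 ≤ (1 + 2 * α) ^ (-(D : ℝ)) * gaussianPdf D μ ((1 + α)⁻¹ • St) x :=
    mul_nonneg (by positivity) (gaussianPdf_nonneg D μ _ hl x)
  have pu : 0 ≤ (1 + 2 * α) ^ ((D : ℝ)) * gaussianPdf D μ ((1 + α) • St) x :=
    mul_nonneg (by positivity) (gaussianPdf_nonneg D μ _ hu x)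
  rw [Real.sqrt_mul pl, sub_sq, Real.sq_sqrt pl, Real.sq_sqrt pu]
  ring
end

section
/- For every real C ≥ 0 and every δ ∈ (0, √2], one has ∫₀^δ √( max(C + ln(1/u), 0) ) du ≤ δ ( √C + √π + √( max(ln(1/δ), 0) ) ). Consequently, if a nonnegative function H on (0, √2] satisfies H(u) ≤ 𝔇 (C + ln(1/u)) for a constant 𝔇 > 0 and all u ∈ (0, √2], then ∫₀^δ √(H(u)) du ≤ φ(δ) where φ(δ) = δ √𝔇 ( √C + √π + √(ln(1/min(δ,1))) ), and δ ↦ φ(δ)/δ is non-increasing. -/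
open MeasureTheory intervalIntegral

lemma aux_int (f : ℝ → ℝ) (hf : ∀ u, 0 ≤ f u) (K A δ : ℝ) (hK : 0 ≤ K) (hδ : 0 < δ)
    (h : ∀ u ∈ Set.Ioc 0 δ, f u ≤ K * (A + (1 + Real.log δ - Real.log u) / 2)) :
    (∫ u in (0 : ℝ)..δ, f u) ≤ K * (δ * (A + Real.sqrt Real.pi)) := by
  have hi : IntervalIntegrable (fun u => K * (A + (1 + Real.log δ - Real.log u) / 2))
      volume 0 δ :=
    (intervalIntegrable_const.add
      ((intervalIntegrable_const.sub intervalIntegral.intervalIntegrable_log').div_const 2)).const_mul K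
  have h1 : (∫ u in (0 : ℝ)..δ, f u) ≤
      ∫ u in (0 : ℝ)..δ, K * (A + (1 + Real.log δ - Real.log u) / 2) := by
    rw [intervalIntegral.integral_of_le hδ.le, intervalIntegral.integral_of_le hδ.le]
    apply integral_mono_of_nonneg
    · exact Filter.Eventually.of_forall hf
    · exact (intervalIntegrable_iff_integrableOn_Ioc_of_le hδ.le).1 hi
    · exact (ae_restrict_iff' measurableSet_Ioc).2 (Filter.Eventually.of_forall h)
  have h2 : (∫ u in (0 : ℝ)..δ, K * (A + (1 + Real.log δ - Real.log u) / 2))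
      = K * (δ * (A + 1)) := by
    have e : ∀ u : ℝ, K * (A + (1 + Real.log δ - Real.log u) / 2)
      = K * (A + (1 + Real.log δ) / 2) - (K / 2) * Real.log u := fun u => by ring
    simp_rw [e]
    rw [intervalIntegral.integral_sub intervalIntegrable_const
      (intervalIntegral.intervalIntegrable_log'.const_mul _),
      intervalIntegral.integral_const, intervalIntegral.integral_const_mul, integral_log]
    simp only [smul_eq_mul]
    simp
    ring
  rw [h2] at h1
  refine h1.trans ?_
  have : 1 ≤ Real.sqrt Real.pi := Real.one_le_sqrt.2 (by linarith [Real.pi_gt_three])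
  gcongr

lemma aux_sqrt_add (x y : ℝ) (hx : 0 ≤ x) (hy : 0 ≤ y) :
    Real.sqrt (x + y) ≤ Real.sqrt x + Real.sqrt y := by
  rw [Real.sqrt_le_left (by positivity)]
  nlinarith [Real.sq_sqrt hx, Real.sq_sqrt hy, Real.sqrt_nonneg x, Real.sqrt_nonneg y,
    mul_nonneg (Real.sqrt_nonneg x) (Real.sqrt_nonneg y)]

lemma aux_pt (C δ u : ℝ) (hC : 0 ≤ C) (hu : u ∈ Set.Ioc 0 δ) :
    Real.sqrt (max (C + Real.log (1 / u)) 0) ≤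
      Real.sqrt C + Real.sqrt (max (Real.log (1 / δ)) 0)
        + (1 + Real.log δ - Real.log u) / 2 := by
  have hl : Real.log u ≤ Real.log δ := Real.log_le_log hu.1 hu.2
  set L := max (Real.log (1 / δ)) 0 with hL
  have hL0 : 0 ≤ L := le_max_right _ _
  have hL1 : Real.log (1 / δ) ≤ L := le_max_left _ _
  rw [one_div, Real.log_inv] at hL1
  have hm : max (C + Real.log (1 / u)) 0 ≤ (C + L) + (Real.log δ - Real.log u) := by
    rw [one_div, Real.log_inv]
    apply max_le <;> linarith
  have h1 := Real.sqrt_le_sqrt hm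
  have h2 := aux_sqrt_add (C + L) (Real.log δ - Real.log u) (by linarith) (by linarith)
  have h3 := aux_sqrt_add C L hC hL0
  have h4 : Real.sqrt (Real.log δ - Real.log u) ≤ (1 + Real.log δ - Real.log u) / 2 := by
    have := Real.sq_sqrt (show 0 ≤ Real.log δ - Real.log u by linarith)
    nlinarith [sq_nonneg (Real.sqrt (Real.log δ - Real.log u) - 1)]
  linarith

lemma aux_log (δ : ℝ) (hδ : 0 < δ) :
    Real.log (1 / min δ 1) = max (Real.log (1 / δ)) 0 := by
  rcases le_total δ 1 with h | h
  · rw [min_eq_left h, max_eq_left]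
    exact Real.log_nonneg (by rw [le_div_iff₀ hδ]; linarith)
  · rw [min_eq_right h, max_eq_right] <;> simp
    exact Real.log_nonneg h

/-- Dudley-type integral bound underlying Proposition 2 of Cohen–Le Pennec. -/
theorem dudley_integral_bound (C : ℝ) (hC : 0 ≤ C) :
    (∀ δ : ℝ, δ ∈ Set.Ioc 0 (Real.sqrt 2) →
      (∫ u in (0 : ℝ)..δ, Real.sqrt (max (C + Real.log (1 / u)) 0)) ≤
        δ * (Real.sqrt C + Real.sqrt Real.pi + Real.sqrt (max (Real.log (1 / δ)) 0))) ∧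
    ∀ 𝔇 : ℝ, 0 < 𝔇 → ∀ H : ℝ → ℝ,
      (∀ u ∈ Set.Ioc (0 : ℝ) (Real.sqrt 2),
        0 ≤ H u ∧ H u ≤ 𝔇 * (C + Real.log (1 / u))) →
      (∀ δ ∈ Set.Ioc (0 : ℝ) (Real.sqrt 2),
        (∫ u in (0 : ℝ)..δ, Real.sqrt (H u)) ≤
          δ * Real.sqrt 𝔇 *
            (Real.sqrt C + Real.sqrt Real.pi + Real.sqrt (Real.log (1 / min δ 1)))) ∧
      AntitoneOn (fun δ : ℝ =>
          (δ * Real.sqrt 𝔇 *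
            (Real.sqrt C + Real.sqrt Real.pi + Real.sqrt (Real.log (1 / min δ 1)))) / δ)
        (Set.Ioi 0) := by
  refine ⟨fun δ hδ => ?_, fun 𝔇 h𝔇 H hH => ⟨fun δ hδ => ?_, ?_⟩⟩
  · refine (aux_int _ (fun u => Real.sqrt_nonneg _) 1
      (Real.sqrt C + Real.sqrt (max (Real.log (1 / δ)) 0)) δ zero_le_one hδ.1
      (fun u hu => ?_)).trans (le_of_eq (by ring))
    rw [one_mul]
    exact aux_pt C δ u hC hu
  · rw [aux_log δ hδ.1]
    refine (aux_int _ (fun u => Real.sqrt_nonneg _) (Real.sqrt 𝔇)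
      (Real.sqrt C + Real.sqrt (max (Real.log (1 / δ)) 0)) δ (Real.sqrt_nonneg _) hδ.1
      (fun u hu => ?_)).trans (le_of_eq (by ring))
    have h1 := (hH u ⟨hu.1, hu.2.trans hδ.2⟩).2
    have h2 : H u ≤ 𝔇 * max (C + Real.log (1 / u)) 0 :=
      h1.trans (mul_le_mul_of_nonneg_left (le_max_left _ _) h𝔇.le)
    refine (Real.sqrt_le_sqrt h2).trans ?_
    rw [Real.sqrt_mul h𝔇.le]
    exact mul_le_mul_of_nonneg_left (aux_pt C δ u hC hu) (Real.sqrt_nonneg _)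
  · intro a ha b hb hab
    have ha' : 0 < a := ha
    have hb' : 0 < b := hb
    have e : ∀ x y : ℝ, 0 < x → x * Real.sqrt 𝔇 * y / x = Real.sqrt 𝔇 * y := by
      intro x y hx
      field_simp
    simp only
    rw [e a _ ha', e b _ hb']
    have hm : 0 < min a 1 := lt_min ha' one_pos
    have hm2 : 0 < min b 1 := lt_min hb' one_pos
    have : Real.log (1 / min b 1) ≤ Real.log (1 / min a 1) :=
      Real.log_le_log (by positivity) (one_div_le_one_div_of_le hm (min_le_min_right 1 hab))
    gcongr
end

section
/- Let 𝔇 > 0, C ≥ 0, and n be a positive integer. Define φ(δ) = δ √𝔇 ( √C + √π + √(ln(1/min(δ,1))) ) for δ > 0. If δ* > 0 satisfies (1/δ*) φ(δ*) = √n δ*, i.e. φ(δ*) = √n (δ*)², then n (δ*)² ≤ 𝔇 ( 2(√C + √π)² + ( ln( n / ((√C + √π)² 𝔇) ) )₊ ), where (a)₊ = max(a, 0). -/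
/-- Model-complexity bound of Proposition 2 of Cohen–Le Pennec: if `δ*` solves
`φ(δ*) = √n (δ*)²` with `φ(δ) = δ√𝔇(√C + √π + √(ln(1/min(δ,1))))`, then
`n (δ*)² ≤ 𝔇 (2(√C+√π)² + (ln(n/((√C+√π)²𝔇)))₊)`. -/
theorem model_complexity_bound
    (𝔇 C : ℝ) (h𝔇 : 0 < 𝔇) (hC : 0 ≤ C) (n : ℕ) (hn : 0 < n)
    (δs : ℝ) (hδs : 0 < δs)
    (hroot : δs * Real.sqrt 𝔇 *
        (Real.sqrt C + Real.sqrt Real.pi + Real.sqrt (Real.log (1 / min δs 1))) =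
      Real.sqrt n * δs ^ 2) :
    (n : ℝ) * δs ^ 2 ≤
      𝔇 * (2 * (Real.sqrt C + Real.sqrt Real.pi) ^ 2 +
        max (Real.log ((n : ℝ) / ((Real.sqrt C + Real.sqrt Real.pi) ^ 2 * 𝔇))) 0) := by
  have ha : 0 < Real.sqrt C + Real.sqrt Real.pi :=
    add_pos_of_nonneg_of_pos (Real.sqrt_nonneg _) (Real.sqrt_pos.2 Real.pi_pos)
  have hn' : (0 : ℝ) < n := by exact_mod_cast hn
  have hm : 0 < min δs 1 := lt_min hδs one_pos
  have hL : 0 ≤ Real.log (1 / min δs 1) :=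
    Real.log_nonneg ((one_le_div hm).2 (min_le_right _ _))
  generalize Real.sqrt C + Real.sqrt Real.pi = a at *
  have hs := Real.sq_sqrt hL
  have hs0 := Real.sqrt_nonneg (Real.log (1 / min δs 1))
  set s := Real.sqrt (Real.log (1 / min δs 1)) with hsdef
  have h1 : Real.sqrt 𝔇 * (a + s) = Real.sqrt n * δs := by
    apply mul_left_cancel₀ hδs.ne'
    linear_combination hroot
  have h2 : 𝔇 * (a + s) ^ 2 = n * δs ^ 2 := by
    have := congrArg (fun x => x ^ 2) h1
    simp only [mul_pow] at this
    rwa [Real.sq_sqrt h𝔇.le, Real.sq_sqrt hn'.le] at this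
  rw [← h2]
  apply mul_le_mul_of_nonneg_left _ h𝔇.le
  have key : 2 * s ^ 2 ≤ max (Real.log ((n : ℝ) / (a ^ 2 * 𝔇))) 0 := by
    rw [hs]
    rcases le_total 1 δs with h | h
    · rw [min_eq_right h]; simp
    · rw [min_eq_left h]
      apply le_max_of_le_left
      have e : 2 * Real.log (1 / δs) = Real.log ((1 / δs) ^ 2) := by
        rw [Real.log_pow]; norm_num
      rw [e]
      apply Real.log_le_log (by positivity)
      rw [div_pow, one_pow, div_le_div_iff₀ (by positivity) (by positivity), ← h2]
      have : a ^ 2 ≤ (a + s) ^ 2 := by nlinarith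
      nlinarith
  nlinarith [sq_nonneg (a - s)]
end

section
/- Let (Z, 𝒜, λ) be a σ-finite measure space, let s₀ and s be probability densities with respect to λ such that s₀ dλ is absolutely continuous with respect to s dλ and the essential supremum ‖s₀/s‖_∞ is finite, and let ρ ∈ (0,1). Then, with C_ρ = (1/ρ) min((1−ρ)/ρ, 1)(ln(1 + ρ/(1−ρ)) − ρ), one has ( C_ρ / (2 + ln ‖s₀/s‖_∞) ) · KL(s₀, s) ≤ JKL_ρ(s₀, s). -/
open MeasureTheory ENNReal
open scoped Classical

/-- Kullback–Leibler divergence between two densities w.r.t. `μ`, with the convention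
that it is `+∞` when absolute continuity fails. -/
noncomputable def KLdiv {Z : Type*} [MeasurableSpace Z] (μ : Measure Z)
    (s t : Z → ℝ) : ℝ≥0∞ :=
  if μ.withDensity (fun z => ENNReal.ofReal (s z)) ≪
      μ.withDensity (fun z => ENNReal.ofReal (t z)) then
    ENNReal.ofReal (∫ z, s z * Real.log (s z / t z) ∂μ)
  else ⊤

/-- Jensen–Kullback–Leibler divergence `JKL_ρ(s,t) = (1/ρ) KL(s, (1−ρ)s + ρt)`. -/
noncomputable def JKLdiv {Z : Type*} [MeasurableSpace Z] (μ : Measure Z) (ρ : ℝ)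
    (s t : Z → ℝ) : ℝ≥0∞ :=
  ENNReal.ofReal (1 / ρ) * KLdiv μ s (fun z => (1 - ρ) * s z + ρ * t z)

/-- The constant `C_ρ`. -/
noncomputable def Crho (ρ : ℝ) : ℝ :=
  (1 / ρ) * min ((1 - ρ) / ρ) 1 * (Real.log (1 + ρ / (1 - ρ)) - ρ)

theorem aux_slope {F F' : ℝ → ℝ} {a b : ℝ} (hab : a < b)
    (hF : ∀ x ∈ Set.Icc a b, HasDerivAt F (F' x) x) :
    ∃ c ∈ Set.Ioo a b, F b - F a = F' c * (b - a) := by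
  obtain ⟨c, hc, h⟩ := exists_hasDerivAt_eq_slope F F' hab
    (fun x hx => (hF x hx).continuousAt.continuousWithinAt)
    (fun x hx => hF x ⟨hx.1.le, hx.2.le⟩)
  refine ⟨c, hc, ?_⟩
  have : b - a ≠ 0 := by linarith
  rw [h]; field_simp

theorem aux_mono {F F' : ℝ → ℝ} {a b : ℝ} (hab : a ≤ b)
    (hF : ∀ x ∈ Set.Icc a b, HasDerivAt F (F' x) x) (hp : ∀ x ∈ Set.Ioo a b, 0 ≤ F' x) :
    F a ≤ F b := by
  rcases hab.eq_or_lt with h | h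
  · rw [h]
  · obtain ⟨c, hc, h1⟩ := aux_slope h hF
    have := mul_nonneg (hp c hc) (sub_nonneg.2 hab)
    linarith

theorem aux_log_upper {x : ℝ} (hx : 1 ≤ x) :
    Real.log x * (2 * (2 * x - 1)) ≤ (x - 1) * (3 * x - 1) := by
  have key := aux_mono (F := fun x => 3 / 4 * x - 5 / 8 - (1 / 4) * (4 * x - 2)⁻¹ - Real.log x)
    (F' := fun x => 3 / 4 * 1 - (1 / 4) * (-(4 * 1) / (4 * x - 2) ^ 2) - x⁻¹) hx
    (by
      intro y hy
      have h1 : (1:ℝ) ≤ y := hy.1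
      have h2 : (4 * y - 2) ≠ 0 := by linarith
      exact (((((hasDerivAt_id y).const_mul (3 / 4)).sub_const (5 / 8))).sub
        (((((hasDerivAt_id y).const_mul 4).sub_const 2).inv h2).const_mul (1 / 4))).sub
        (Real.hasDerivAt_log (by linarith)))
    (by
      intro y hy
      have h1 : (1:ℝ) < y := hy.1
      have h2 : 0 < (4 * y - 2) := by linarith
      have h3 : 0 < y := by linarith
      have : 3 / 4 * 1 - (1 / 4) * (-(4 * 1) / (4 * y - 2) ^ 2) - y⁻¹
          = 4 * ((y - 1) ^ 2 * (3 * y - 1)) / (y * (4 * y - 2) ^ 2) := by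
        field_simp; ring
      show 0 ≤ 3 / 4 * 1 - (1 / 4) * (-(4 * 1) / (4 * y - 2) ^ 2) - y⁻¹
      rw [this]
      have : 0 < 3 * y - 1 := by linarith
      positivity)
  have h2 : 0 < (4 * x - 2) := by linarith
  norm_num at key
  have h3 : Real.log x ≤ 3 / 4 * x - 5 / 8 - 1 / 4 * (4 * x - 2)⁻¹ := by linarith
  calc Real.log x * (2 * (2 * x - 1)) = Real.log x * (4 * x - 2) := by ring
    _ ≤ (3 / 4 * x - 5 / 8 - 1 / 4 * (4 * x - 2)⁻¹) * (4 * x - 2) := by gcongr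
    _ = _ := by field_simp; ring

theorem aux_log_lower {y : ℝ} (hy : 1 ≤ y) : -(y ^ 2 - 4 * y + 3) / 2 ≤ Real.log y := by
  have key := aux_mono (F := fun x => Real.log x - (-(x ^ 2 - 4 * x + 3) / 2))
    (F' := fun x => x⁻¹ - (2 - x)) hy
    (by
      intro z hz
      have h1 : (1:ℝ) ≤ z := hz.1
      have h := (Real.hasDerivAt_log (x := z) (by linarith)).sub
        ((((((hasDerivAt_id z).pow 2).sub ((hasDerivAt_id z).const_mul 4)).add_const 3).neg).div_const 2)
      refine h.congr_deriv ?_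
      simp; ring)
    (by
      intro z hz
      have h1 : (1:ℝ) < z := hz.1
      have h3 : 0 < z := by linarith
      have : z⁻¹ - (2 - z) = (z - 1) ^ 2 / z := by field_simp; ring
      show 0 ≤ z⁻¹ - (2 - z)
      rw [this]; positivity)
  norm_num at key
  linarith

/-- KL integrand bounded by Hellinger integrand. -/
theorem aux_A {α β M : ℝ} (hα : 0 < α) (hβ : 0 < β) (hM : 1 ≤ M) (h : α ^ 2 / β ^ 2 ≤ M) :
    α ^ 2 * Real.log (α ^ 2 / β ^ 2) - α ^ 2 + β ^ 2 ≤ (2 + Real.log M) * (α - β) ^ 2 := by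
  have hlM : 0 ≤ Real.log M := Real.log_nonneg hM
  rw [← div_pow] at h ⊢
  rw [Real.log_pow]
  push_cast
  rcases le_total β α with hc | hc
  · have hx : 1 ≤ α / β := by rwa [one_le_div hβ]
    have h1 := aux_log_upper hx
    have h2 : 2 * Real.log (α / β) ≤ Real.log M := by
      have := Real.log_le_log (by positivity) h
      rw [Real.log_pow] at this
      exact_mod_cast this
    have h3 : (2 + 2 * Real.log (α / β)) * (α - β) ^ 2 ≤ (2 + Real.log M) * (α - β) ^ 2 := by
      gcongr
    refine le_trans ?_ h3
    set l := Real.log (α / β)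
    obtain ⟨x, hxd⟩ : ∃ x, x = α / β := ⟨_, rfl⟩
    rw [← hxd] at h1
    have : α = x * β := by rw [hxd]; field_simp
    rw [this]
    nlinarith [mul_le_mul_of_nonneg_left h1 (sq_nonneg β)]
  · have hx : 1 ≤ β / α := by rwa [one_le_div hα]
    have h1 := aux_log_lower hx
    have h2 : Real.log (α / β) = - Real.log (β / α) := by
      rw [← Real.log_inv, inv_div]
    rw [h2]
    have h3 : 2 * (α - β) ^ 2 ≤ (2 + Real.log M) * (α - β) ^ 2 := by
      gcongr; linarith
    refine le_trans ?_ h3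
    set l := Real.log (β / α)
    obtain ⟨x, hxd⟩ : ∃ x, x = β / α := ⟨_, rfl⟩
    rw [← hxd] at h1
    have : β = x * α := by rw [hxd]; field_simp
    rw [this]
    nlinarith [mul_le_mul_of_nonneg_left h1 (sq_nonneg α)]

/-- The constant `ρ C_ρ`. -/
theorem aux_c {ρ : ℝ} (hρ0 : 0 < ρ) (hρ1 : ρ < 1) :
    ∃ c, Crho ρ = c / ρ ∧ 0 ≤ c ∧ c ≤ -Real.log (1 - ρ) - ρ ∧ c ≤ ρ ∧ c ≤ 2 * ρ ^ 2 := by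
  have h1 : 0 < 1 - ρ := by linarith
  have hl : Real.log (1 + ρ / (1 - ρ)) = - Real.log (1 - ρ) := by
    rw [← Real.log_inv]; congr 1; field_simp; ring
  have hK0 : 0 ≤ -Real.log (1 - ρ) - ρ := by
    have := Real.log_le_sub_one_of_pos h1
    linarith
  have hK1 : -Real.log (1 - ρ) - ρ ≤ ρ ^ 2 / (1 - ρ) := by
    have := Real.log_le_sub_one_of_pos (inv_pos.2 h1)
    rw [Real.log_inv] at this
    have h2 : ρ ^ 2 / (1 - ρ) = (1 - ρ)⁻¹ - 1 - ρ := by field_simp; ring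
    linarith
  set K := -Real.log (1 - ρ) - ρ with hK
  refine ⟨min ((1 - ρ) / ρ) 1 * K, ?_, ?_, ?_, ?_, ?_⟩
  · rw [Crho, hl]; ring
  · positivity
  · calc _ ≤ 1 * K := by gcongr; exact min_le_right _ _
      _ = K := one_mul _
  · calc _ ≤ ((1 - ρ) / ρ) * (ρ ^ 2 / (1 - ρ)) := by gcongr; exact min_le_left _ _
      _ = ρ := by field_simp
  · rcases le_total ρ (1 / 2) with h | h
    · calc _ ≤ 1 * (ρ ^ 2 / (1 - ρ)) := by gcongr; exact min_le_right _ _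
        _ ≤ 2 * ρ ^ 2 := by
          rw [one_mul, div_le_iff₀ h1]; nlinarith [sq_nonneg ρ]
    · calc _ ≤ ((1 - ρ) / ρ) * (ρ ^ 2 / (1 - ρ)) := by gcongr; exact min_le_left _ _
        _ = ρ := by field_simp
        _ ≤ 2 * ρ ^ 2 := by nlinarith

theorem aux_B {ρ c x : ℝ} (hρ0 : 0 < ρ) (hρ1 : ρ < 1) (hc0 : 0 ≤ c)
    (hcK : c ≤ -Real.log (1 - ρ) - ρ) (hc1 : c ≤ ρ) (hc2 : c ≤ 2 * ρ ^ 2) (hx : 0 ≤ x) :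
    c * (1 - x) ^ 2 ≤ ρ * (x ^ 2 - 1) - Real.log (1 - ρ + ρ * x ^ 2) := by
  have hpos : ∀ y : ℝ, 0 < 1 - ρ + ρ * y ^ 2 := fun y => by nlinarith [sq_nonneg y]
  obtain ⟨D, hD⟩ : ∃ D : ℝ → ℝ, D = fun y =>
    ρ * (y ^ 2 - 1) - Real.log (1 - ρ + ρ * y ^ 2) - c * (1 - y) ^ 2 := ⟨_, rfl⟩
  obtain ⟨p, hp⟩ : ∃ p : ℝ → ℝ, p = fun y =>
    c * (1 - ρ + ρ * y ^ 2) - ρ ^ 2 * y - ρ ^ 2 * y ^ 2 := ⟨_, rfl⟩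
  have hder : ∀ y, HasDerivAt D (2 * (1 - y) * p y / (1 - ρ + ρ * y ^ 2)) y := by
    intro y
    have e1 : HasDerivAt (fun y : ℝ => y ^ 2) (2 * y) y := by
      simpa using hasDerivAt_pow 2 y
    have e2 : HasDerivAt (fun y : ℝ => (1 - y) ^ 2) (-(2 * (1 - y))) y := by
      have := ((hasDerivAt_id y).const_sub 1).pow 2
      refine (this.congr_deriv (by simp)).congr_of_eventuallyEq ?_
      filter_upwards with z
      simp
    have h := (((e1.sub_const 1).const_mul ρ).sub
      (((e1.const_mul ρ).const_add (1 - ρ)).log (hpos y).ne')).sub (e2.const_mul c)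
    rw [hD]
    refine h.congr_deriv ?_
    have := (hpos y).ne'
    rw [hp]
    field_simp
    ring
  have hD1 : D 1 = 0 := by simp [hD]
  have hD0 : 0 ≤ D 0 := by simp [hD]; linarith
  suffices 0 ≤ D x by rw [hD] at this; simp only at this; linarith
  rcases le_total x 1 with h | h
  · by_contra hneg
    push Not at hneg
    have hx0 : 0 < x := by
      rcases hx.eq_or_lt with h | h
      · rw [← h] at hneg; linarith
      · exact h
    have hx1 : x < 1 := by
      rcases h.eq_or_lt with h | h
      · rw [h] at hneg; linarith
      · exact h
    obtain ⟨a, ha, h1⟩ := aux_slope hx0 (fun y _ => hder y)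
    obtain ⟨b, hb, h2⟩ := aux_slope hx1 (fun y _ => hder y)
    have ha0 : 0 < a := ha.1
    have hab : a < b := ha.2.trans hb.1
    have hb1 : b < 1 := hb.2
    have hpa : p a < 0 := by
      by_contra hcon
      push Not at hcon
      have : 0 ≤ 2 * (1 - a) * p a / (1 - ρ + ρ * a ^ 2) * (x - 0) := by
        have := hpos a
        have : 0 ≤ 1 - a := by linarith
        have : 0 ≤ x - 0 := by linarith
        positivity
      linarith
    have hpb : 0 < p b := by
      by_contra hcon
      push Not at hcon
      have : 0 ≤ 2 * (1 - b) * (- p b) / (1 - ρ + ρ * b ^ 2) * (1 - x) := by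
        have := hpos b
        have : 0 ≤ 1 - b := by linarith
        have : 0 ≤ 1 - x := by linarith
        have : 0 ≤ - p b := by linarith
        positivity
      have e : 2 * (1 - b) * (- p b) / (1 - ρ + ρ * b ^ 2) * (1 - x)
        = - (2 * (1 - b) * (p b) / (1 - ρ + ρ * b ^ 2) * (1 - x)) := by ring
      linarith
    have : p b ≤ p a := by
      rw [hp]
      have e1 : 0 ≤ (ρ * (ρ - c)) * (b ^ 2 - a ^ 2) := by
        apply mul_nonneg
        · apply mul_nonneg hρ0.le; linarith
        · nlinarith
      have e2 : 0 ≤ ρ ^ 2 * (b - a) := by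
        apply mul_nonneg (sq_nonneg _); linarith
      simp only
      nlinarith
    linarith
  · rw [← hD1]
    refine aux_mono h (fun y _ => hder y) ?_
    intro y hy
    have hy1 : 1 < y := hy.1
    have hpy : p y ≤ 0 := by
      rw [hp]
      have e1 : 0 ≤ (ρ * (ρ - c)) * (y ^ 2 - 1) := by
        apply mul_nonneg
        · apply mul_nonneg hρ0.le; linarith
        · nlinarith
      have e2 : 0 ≤ ρ ^ 2 * (y - 1) := by
        apply mul_nonneg (sq_nonneg _); linarith
      simp only
      nlinarith
    apply div_nonneg _ (hpos y).le
    nlinarith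

/-- Jensen-KL integrand bounds Hellinger integrand. -/
theorem aux_B2 {ρ c α β : ℝ} (hρ0 : 0 < ρ) (hρ1 : ρ < 1) (hc0 : 0 ≤ c)
    (hcK : c ≤ -Real.log (1 - ρ) - ρ) (hc1 : c ≤ ρ) (hc2 : c ≤ 2 * ρ ^ 2)
    (hα : 0 < α) (hβ : 0 ≤ β) :
    c * (α - β) ^ 2 ≤ α ^ 2 * Real.log (α ^ 2 / ((1 - ρ) * α ^ 2 + ρ * β ^ 2))
      - ρ * α ^ 2 + ρ * β ^ 2 := by
  have h := aux_B hρ0 hρ1 hc0 hcK hc1 hc2 (x := β / α) (by positivity)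
  have hl : Real.log (α ^ 2 / ((1 - ρ) * α ^ 2 + ρ * β ^ 2))
      = - Real.log (1 - ρ + ρ * (β / α) ^ 2) := by
    rw [← Real.log_inv]; congr 1
    field_simp
  rw [hl]
  set l := Real.log (1 - ρ + ρ * (β / α) ^ 2)
  obtain ⟨x, hxd⟩ : ∃ x, x = β / α := ⟨_, rfl⟩
  rw [← hxd] at h
  have : β = x * α := by rw [hxd]; field_simp
  rw [this]
  nlinarith [mul_le_mul_of_nonneg_left h (sq_nonneg α)]

/-- All pointwise facts. -/
theorem aux_pt_s16 {ρ c a b M : ℝ} (hρ0 : 0 < ρ) (hρ1 : ρ < 1) (hc0 : 0 ≤ c)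
    (hcK : c ≤ -Real.log (1 - ρ) - ρ) (hc1 : c ≤ ρ) (hc2 : c ≤ 2 * ρ ^ 2)
    (ha : 0 ≤ a) (hb : 0 ≤ b) (hab : b = 0 → a = 0) (hM : 1 ≤ M) (h : a / b ≤ M) :
    0 ≤ a * Real.log (a / b) - a + b ∧
    a * Real.log (a / b) - a + b ≤ (2 + Real.log M) * (2 * a + 2 * b) ∧
    0 ≤ a * Real.log (a / ((1 - ρ) * a + ρ * b)) - ρ * a + ρ * b ∧
    a * Real.log (a / ((1 - ρ) * a + ρ * b)) ≤ - Real.log (1 - ρ) * a ∧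
    c / (2 + Real.log M) * (a * Real.log (a / b) - a + b) ≤
      a * Real.log (a / ((1 - ρ) * a + ρ * b)) - ρ * a + ρ * b := by
  have hlM : 0 ≤ Real.log M := Real.log_nonneg hM
  rcases ha.eq_or_lt with h0 | h0
  · subst h0
    simp only [zero_mul, mul_zero, zero_add, sub_zero]
    refine ⟨hb, by nlinarith, by positivity, by simp, ?_⟩
    gcongr
    rw [div_le_iff₀ (by linarith)]
    nlinarith
  have hb0 : 0 < b := by
    rcases hb.eq_or_lt with h1 | h1
    · have := hab h1.symm; linarith
    · exact h1
  have h1ρ : 0 < 1 - ρ := by linarith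
  have hA := aux_A (α := √a) (β := √b) (by positivity) (by positivity) hM
    (by rw [Real.sq_sqrt ha, Real.sq_sqrt hb]; exact h)
  have hB := aux_B2 (α := √a) (β := √b) hρ0 hρ1 hc0 hcK hc1 hc2 (by positivity) (by positivity)
  rw [Real.sq_sqrt ha, Real.sq_sqrt hb] at hA hB
  have hH : (√a - √b) ^ 2 ≤ 2 * a + 2 * b := by
    nlinarith [sq_nonneg (√a + √b), Real.sq_sqrt ha, Real.sq_sqrt hb]
  refine ⟨?_, ?_, ?_, ?_, ?_⟩
  · have := Real.log_le_sub_one_of_pos (x := b / a) (by positivity)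
    have e : Real.log (a / b) = - Real.log (b / a) := by rw [← Real.log_inv, inv_div]
    rw [e]
    have h2 := mul_le_mul_of_nonneg_left this ha
    have h3 : a * (b / a - 1) = b - a := by field_simp
    linarith
  · exact hA.trans (by gcongr)
  · exact le_trans (by positivity) hB
  · rw [mul_comm, ← Real.log_inv]
    gcongr
    rw [div_le_iff₀ (by positivity), inv_mul_eq_div, le_div_iff₀ h1ρ]
    nlinarith
  · refine le_trans ?_ hB
    calc _ ≤ c / (2 + Real.log M) * ((2 + Real.log M) * (√a - √b) ^ 2) := by gcongr
      _ = _ := by field_simp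

/-- Lower bound on `JKL_ρ(s₀, s)` in terms of `KL(s₀, s)` when `‖s₀/s‖_∞ < ∞`. -/
theorem kl_le_jkl_of_bounded_ratio
    {Z : Type*} [MeasurableSpace Z] (μ : Measure Z) [SigmaFinite μ]
    (s₀ s : Z → ℝ) (hs₀ : Measurable s₀) (hs : Measurable s)
    (hs₀0 : ∀ z, 0 ≤ s₀ z) (hs0 : ∀ z, 0 ≤ s z)
    (hs₀1 : ∫ z, s₀ z ∂μ = 1) (hs1 : ∫ z, s z ∂μ = 1)
    (hac : μ.withDensity (fun z => ENNReal.ofReal (s₀ z)) ≪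
      μ.withDensity (fun z => ENNReal.ofReal (s z)))
    (hbdd : ∃ M : ℝ, ∀ᵐ z ∂μ, s₀ z / s z ≤ M)
    (ρ : ℝ) (hρ0 : 0 < ρ) (hρ1 : ρ < 1) :
    ENNReal.ofReal (Crho ρ / (2 + Real.log (essSup (fun z => s₀ z / s z) μ))) *
        KLdiv μ s₀ s ≤ JKLdiv μ ρ s₀ s := by
  obtain ⟨c, hC, hc0, hcK, hc1, hc2⟩ := aux_c hρ0 hρ1
  have h1ρ : 0 < 1 - ρ := by linarith
  have hi₀ : Integrable s₀ μ := by
    by_contra hcon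
    rw [integral_undef hcon] at hs₀1
    exact zero_ne_one hs₀1
  have hi : Integrable s μ := by
    by_contra hcon
    rw [integral_undef hcon] at hs1
    exact zero_ne_one hs1
  -- absolute continuity, pointwise
  have hae : ∀ᵐ z ∂μ, s z = 0 → s₀ z = 0 := by
    have h1 : μ.withDensity (fun z => ENNReal.ofReal (s z)) {z | s z = 0} = 0 := by
      rw [withDensity_apply_eq_zero hs.ennreal_ofReal]
      convert measure_empty (μ := μ)
      ext z
      simp only [Set.mem_inter_iff, Set.mem_setOf_eq, Set.mem_empty_iff_false, iff_false, not_and]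
      intro h2 h3
      exact h2 (by simp [h3])
    have h2 := hac h1
    rw [withDensity_apply_eq_zero hs₀.ennreal_ofReal] at h2
    rw [ae_iff]
    refine measure_mono_null ?_ h2
    intro z hz
    simp only [Set.mem_setOf_eq, Classical.not_imp] at hz
    refine ⟨?_, hz.1⟩
    simp only [Set.mem_setOf_eq, ne_eq, ENNReal.ofReal_eq_zero, not_le]
    exact lt_of_le_of_ne (hs₀0 z) (Ne.symm hz.2)
  set M := essSup (fun z => s₀ z / s z) μ with hMdef
  have hbound : ∀ᵐ z ∂μ, s₀ z / s z ≤ M := by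
    apply _root_.ae_le_essSup
    obtain ⟨B, hB⟩ := hbdd
    exact ⟨B, by simpa using hB⟩
  have hM : 1 ≤ M := by
    have h1 : ∫ z, s₀ z ∂μ ≤ ∫ z, M * s z ∂μ := by
      refine integral_mono_ae hi₀ (hi.const_mul M) ?_
      filter_upwards [hae, hbound] with z h1 h2
      rcases (hs0 z).eq_or_lt with h3 | h3
      · rw [h1 h3.symm, ← h3]; simp
      · rwa [div_le_iff₀ h3] at h2
    rw [integral_const_mul, hs₀1, hs1] at h1
    linarith
  have hlM : 0 ≤ Real.log M := Real.log_nonneg hM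
  have hpt := (hae.and hbound).mono (fun z h =>
    aux_pt_s16 hρ0 hρ1 hc0 hcK hc1 hc2 (hs₀0 z) (hs0 z) h.1 hM h.2)
  -- the two integrands
  have hI1 : Integrable (fun z => s₀ z * Real.log (s₀ z / s z) - s₀ z + s z) μ := by
    refine Integrable.mono' (g := fun z => (2 + Real.log M) * (2 * s₀ z + 2 * s z))
      (((hi₀.const_mul 2).add (hi.const_mul 2)).const_mul _)
      (by apply Measurable.aestronglyMeasurable; fun_prop) ?_
    filter_upwards [hpt] with z hz
    rw [Real.norm_of_nonneg hz.1]
    exact hz.2.1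
  have hI2 : Integrable (fun z => s₀ z * Real.log (s₀ z / ((1 - ρ) * s₀ z + ρ * s z))
      - ρ * s₀ z + ρ * s z) μ := by
    refine Integrable.mono' (g := fun z => - Real.log (1 - ρ) * s₀ z - ρ * s₀ z + ρ * s z)
      (((hi₀.const_mul _).sub (hi₀.const_mul ρ)).add (hi.const_mul ρ))
      (by apply Measurable.aestronglyMeasurable; fun_prop) ?_
    filter_upwards [hpt] with z hz
    rw [Real.norm_of_nonneg hz.2.2.1]
    have := hz.2.2.2.1
    linarith
  have hE1 : ∫ z, (s₀ z * Real.log (s₀ z / s z) - s₀ z + s z) ∂μ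
      = ∫ z, s₀ z * Real.log (s₀ z / s z) ∂μ := by
    have hJ : Integrable (fun z => s₀ z * Real.log (s₀ z / s z)) μ := by
      refine ((hI1.add hi₀).sub hi).congr ?_
      filter_upwards with z
      simp only [Pi.add_apply, Pi.sub_apply]
      ring
    have hS : Integrable (fun z => s₀ z * Real.log (s₀ z / s z) - s₀ z) μ := hJ.sub hi₀
    rw [integral_add hS hi, integral_sub hJ hi₀, hs₀1, hs1]
    ring
  have hE2 : ∫ z, (s₀ z * Real.log (s₀ z / ((1 - ρ) * s₀ z + ρ * s z))
      - ρ * s₀ z + ρ * s z) ∂μ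
      = ∫ z, s₀ z * Real.log (s₀ z / ((1 - ρ) * s₀ z + ρ * s z)) ∂μ := by
    have hJ : Integrable (fun z => s₀ z * Real.log (s₀ z / ((1 - ρ) * s₀ z + ρ * s z))) μ := by
      refine ((hI2.add (hi₀.const_mul ρ)).sub (hi.const_mul ρ)).congr ?_
      filter_upwards with z
      simp only [Pi.add_apply, Pi.sub_apply]
      ring
    have hS : Integrable (fun z => s₀ z * Real.log (s₀ z / ((1 - ρ) * s₀ z + ρ * s z))
        - ρ * s₀ z) μ := hJ.sub (hi₀.const_mul ρ)
    rw [integral_add hS (hi.const_mul ρ),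
      integral_sub hJ (hi₀.const_mul ρ), integral_const_mul, integral_const_mul, hs₀1, hs1]
    ring
  have hmain : c / (2 + Real.log M) * ∫ z, s₀ z * Real.log (s₀ z / s z) ∂μ
      ≤ ∫ z, s₀ z * Real.log (s₀ z / ((1 - ρ) * s₀ z + ρ * s z)) ∂μ := by
    rw [← hE1, ← hE2, ← integral_const_mul]
    refine integral_mono_ae (hI1.const_mul _) hI2 ?_
    filter_upwards [hpt] with z hz
    exact hz.2.2.2.2
  rw [JKLdiv, KLdiv, KLdiv, if_pos hac]
  split_ifs with hac2
  · rw [← ENNReal.ofReal_mul (by rw [hC]; positivity), ← ENNReal.ofReal_mul (by positivity)]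
    apply ENNReal.ofReal_le_ofReal
    rw [hC]
    calc _ = 1 / ρ * (c / (2 + Real.log M) * ∫ z, s₀ z * Real.log (s₀ z / s z) ∂μ) := by
          field_simp
      _ ≤ _ := by gcongr
  · rw [ENNReal.mul_top]
    · exact le_top
    · simp [hρ0]
end

section
/- Let K be a positive integer, 𝒴 a set, and W a set of functions w = (w_k)_{k=1}^K from 𝒴 to ℝ^K. For w ∈ W define the normalized (softmax) gating functions g_k(y; w) = exp(w_k(y)) / Σ_{l=1}^K exp(w_l(y)), and let 𝒫_W = { (g_k(·; w))_{k=1}^K : w ∈ W }. Equip 𝒫_W with the distance sup_y d_k(g, g') = sup_{y∈𝒴} ( Σ_{k=1}^K (√g_k(y) − √g'_k(y))² )^{1/2}, and equip W with the distance d_∞(w, w') = max_{k∈{1,…,K}} sup_{y∈𝒴} |w_k(y) − w'_k(y)|. Then for every δ ∈ (0, √2], the bracketing number of 𝒫_W is bounded by the covering number of W: N_{[·], sup_y d_k}( δ/2, 𝒫_W ) ≤ N( 3√3 δ / (8√K), W, d_∞ ), where N(r, W, d_∞) denotes the minimal number of d_∞-balls of radius at most r needed to cover W. -/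
open ENNReal

/-- Minimal number of `δ`-brackets (w.r.t. a pseudodistance `d` and the pointwise order)
needed to cover `S`; `⊤` if no finite bracket covering exists. -/
noncomputable def bracketingNumber {F : Type*} [LE F] (d : F → F → ℝ≥0∞) (δ : ℝ≥0∞)
    (S : Set F) : ℝ≥0∞ :=
  ⨅ (B : Finset (F × F)) (_ : (∀ b ∈ B, d b.1 b.2 ≤ δ) ∧
      ∀ s ∈ S, ∃ b ∈ B, b.1 ≤ s ∧ s ≤ b.2), (B.card : ℝ≥0∞)

/-- Minimal number of `d`-balls of radius at most `r` needed to cover `S`;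
`⊤` if no finite covering exists. -/
noncomputable def coveringNumber {F : Type*} (d : F → F → ℝ≥0∞) (r : ℝ≥0∞)
    (S : Set F) : ℝ≥0∞ :=
  ⨅ (B : Finset F) (_ : ∀ s ∈ S, ∃ c ∈ B, d s c ≤ r), (B.card : ℝ≥0∞)

/-- `sup_y d_k` distance on gating functions. -/
noncomputable def supdk (K : ℕ) {𝒴 : Type*} (g g' : 𝒴 → Fin K → ℝ) : ℝ≥0∞ :=
  ⨆ y : 𝒴, ENNReal.ofReal (Real.sqrt (∑ k,
    (Real.sqrt (g y k) - Real.sqrt (g' y k)) ^ 2))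

/-- The `d_∞` distance `max_k sup_y |w_k(y) − w'_k(y)|` on tuples of functions. -/
noncomputable def dInfty (K : ℕ) {𝒴 : Type*} (w w' : 𝒴 → Fin K → ℝ) : ℝ≥0∞ :=
  ⨆ k : Fin K, ⨆ y : 𝒴, ENNReal.ofReal |w y k - w' y k|

/-- The softmax coordinate `k` of `c`, with the `k`-th exponent shifted by `s`. -/
noncomputable def shiftGate {K : ℕ} {Y : Type*} (s : ℝ) (c : Y → Fin K → ℝ) : Y → Fin K → ℝ :=
  fun y k => Real.exp (c y k + s) /
    (Real.exp (c y k + s) + ∑ l ∈ Finset.univ.erase k, Real.exp (c y l))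

lemma cubic_bound (x : ℝ) (hx : 0 ≤ x) : x * (1 - x ^ 2) ≤ 2 * Real.sqrt 3 / 9 := by
  have h3 : Real.sqrt 3 ^ 2 = 3 := Real.sq_sqrt (by norm_num)
  have hp : 0 ≤ Real.sqrt 3 := Real.sqrt_nonneg 3
  have key : 0 ≤ (x - Real.sqrt 3 / 3) ^ 2 * (x + 2 * (Real.sqrt 3 / 3)) := by positivity
  have : (x - Real.sqrt 3 / 3) ^ 2 * (x + 2 * (Real.sqrt 3 / 3))
      = x ^ 3 - x * Real.sqrt 3 ^ 2 / 3 + 2 * Real.sqrt 3 * Real.sqrt 3 ^ 2 / 27 := by ring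
  rw [this, h3] at key
  linarith

lemma sqrt_gate_lip (a b : ℝ) (hb : 0 ≤ b) (s t : ℝ) :
    |Real.sqrt (Real.exp (a + t) / (Real.exp (a + t) + b))
      - Real.sqrt (Real.exp (a + s) / (Real.exp (a + s) + b))|
      ≤ Real.sqrt 3 / 9 * |t - s| := by
  let f : ℝ → ℝ := fun u => Real.sqrt (Real.exp (a + u) / (Real.exp (a + u) + b))
  let f' : ℝ → ℝ := fun u => f u * (1 - (f u) ^ 2) / 2
  have hq : ∀ u, 0 < Real.exp (a + u) / (Real.exp (a + u) + b) := fun u => by positivity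
  have hq1 : ∀ u, Real.exp (a + u) / (Real.exp (a + u) + b) ≤ 1 := fun u => by
    rw [div_le_one (by positivity)]; linarith
  have hsq : ∀ u, f u ^ 2 = Real.exp (a + u) / (Real.exp (a + u) + b) :=
    fun u => Real.sq_sqrt (hq u).le
  have hpos : ∀ u, 0 < f u := fun u => Real.sqrt_pos.2 (hq u)
  have hder : ∀ u, HasDerivAt f (f' u) u := by
    intro u
    have he : HasDerivAt (fun u : ℝ => Real.exp (a + u)) (Real.exp (a + u)) u := by
      simpa using ((hasDerivAt_id u).const_add a).exp
    have hd : Real.exp (a + u) + b ≠ 0 := by positivity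
    have h1 := (he.div (he.add_const b) hd).sqrt (hq u).ne'
    refine h1.congr_deriv ?_
    have hf : Real.sqrt (Real.exp (a + u) / (Real.exp (a + u) + b)) = f u := rfl
    have hfu := hpos u
    have e : (Real.exp (a + u) * (Real.exp (a + u) + b) - Real.exp (a + u) * Real.exp (a + u)) /
        (Real.exp (a + u) + b) ^ 2 = f u ^ 2 * (1 - f u ^ 2) := by
      rw [hsq]; field_simp
    simp only [Pi.div_apply]
    rw [e, hf]
    simp only [f']
    field_simp
  have hbd : ∀ u ∈ (Set.univ : Set ℝ), ‖f' u‖ ≤ Real.sqrt 3 / 9 := by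
    intro u _
    have h1 : 0 ≤ 1 - f u ^ 2 := by rw [hsq]; linarith [hq1 u]
    have h2 : 0 ≤ f' u := by
      have := hpos u
      simp only [f']; positivity
    rw [Real.norm_of_nonneg h2]
    have := cubic_bound (f u) (hpos u).le
    simp only [f']; linarith
  have := Convex.norm_image_sub_le_of_norm_hasDerivWithin_le (s := Set.univ)
    (fun u _ => (hder u).hasDerivWithinAt) hbd convex_univ (Set.mem_univ s) (Set.mem_univ t)
  simpa [Real.norm_eq_abs] using this

lemma frac_le {a b a' b' : ℝ} (ha : 0 < a) (hb : 0 ≤ b) (ha' : 0 < a') (hb' : 0 ≤ b')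
    (h : a * b' ≤ a' * b) : a / (a + b) ≤ a' / (a' + b') := by
  rw [div_le_div_iff₀ (by positivity) (by positivity)]
  nlinarith

lemma softmax_eq {K : ℕ} (v : Fin K → ℝ) (k : Fin K) :
    Real.exp (v k) / ∑ l, Real.exp (v l)
      = Real.exp (v k) / (Real.exp (v k) + ∑ l ∈ Finset.univ.erase k, Real.exp (v l)) := by
  rw [Finset.add_sum_erase _ (fun l => Real.exp (v l)) (Finset.mem_univ k)]

/-- The bracketing number of a family of softmax gating functions is bounded by the
covering number of the underlying family of weight functions. -/
theorem softmax_gating_bracketing_le_covering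
    (K : ℕ) (hK : 0 < K) {𝒴 : Type*} (W : Set (𝒴 → Fin K → ℝ))
    (δ : ℝ) (hδ0 : 0 < δ) (hδ2 : δ ≤ Real.sqrt 2) :
    bracketingNumber (supdk K) (ENNReal.ofReal (δ / 2))
        {g : 𝒴 → Fin K → ℝ | ∃ w ∈ W,
          g = fun y k => Real.exp (w y k) / ∑ l, Real.exp (w y l)} ≤
      coveringNumber (dInfty K) (ENNReal.ofReal (3 * Real.sqrt 3 * δ / (8 * Real.sqrt K)))
        W := by
  classical
  have hKr : (0 : ℝ) < K := by exact_mod_cast hK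
  have hsK : 0 < Real.sqrt K := Real.sqrt_pos.2 hKr
  have hs3 : Real.sqrt 3 ^ 2 = 3 := Real.sq_sqrt (by norm_num)
  set r : ℝ := 3 * Real.sqrt 3 * δ / (8 * Real.sqrt K) with hr
  have hr0 : 0 ≤ r := by positivity
  have hrC : Real.sqrt 3 / 9 * (4 * r) = δ / (2 * Real.sqrt K) := by
    have : Real.sqrt 3 / 9 * (4 * r) = Real.sqrt 3 ^ 2 * δ / (6 * Real.sqrt K) := by
      rw [hr]; field_simp; ring
    rw [this, hs3]; field_simp; ring
  unfold coveringNumber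
  refine le_iInf₂ fun B hB => ?_
  unfold bracketingNumber
  refine (iInf₂_le (B.image fun c => (shiftGate (-(2 * r)) c, shiftGate (2 * r) c))
    ⟨?_, ?_⟩).trans (by exact_mod_cast Finset.card_image_le)
  · intro b hb
    obtain ⟨c, _, rfl⟩ := Finset.mem_image.1 hb
    refine iSup_le fun y => ENNReal.ofReal_le_ofReal ?_
    refine Real.sqrt_le_iff.2 ⟨by positivity, ?_⟩
    have hk : ∀ k ∈ (Finset.univ : Finset (Fin K)),
        (Real.sqrt (shiftGate (-(2 * r)) c y k) - Real.sqrt (shiftGate (2 * r) c y k)) ^ 2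
          ≤ (δ / (2 * Real.sqrt K)) ^ 2 := by
      intro k _
      have h := sqrt_gate_lip (c y k) (∑ l ∈ Finset.univ.erase k, Real.exp (c y l))
        (Finset.sum_nonneg fun l _ => (Real.exp_pos _).le) (2 * r) (-(2 * r))
      have e : |-(2 * r) - 2 * r| = 4 * r := by
        rw [abs_of_nonpos (by linarith)]; ring
      rw [e, hrC] at h
      refine sq_le_sq' (abs_le.1 ?_).1 (abs_le.1 ?_).2
      all_goals
        simp only [shiftGate]
        convert h using 6
    refine (Finset.sum_le_sum hk).trans (le_of_eq ?_)
    rw [Finset.sum_const, Finset.card_univ, Fintype.card_fin, nsmul_eq_mul, div_pow, mul_pow,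
      Real.sq_sqrt hKr.le]
    field_simp
  · rintro s ⟨w, hw, rfl⟩
    obtain ⟨c, hc, hd⟩ := hB w hw
    have hwc : ∀ y k, |w y k - c y k| ≤ r := by
      intro y k
      have : ENNReal.ofReal |w y k - c y k| ≤ ENNReal.ofReal r :=
        ((le_iSup (fun y => ENNReal.ofReal |w y k - c y k|) y).trans
          (le_iSup (fun k => ⨆ y, ENNReal.ofReal |w y k - c y k|) k)).trans hd
      exact (ENNReal.ofReal_le_ofReal_iff hr0).1 this
    refine ⟨_, Finset.mem_image_of_mem _ hc, ?_, ?_⟩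
    · intro y k
      show shiftGate (-(2 * r)) c y k ≤ Real.exp (w y k) / ∑ l, Real.exp (w y l)
      rw [softmax_eq]
      simp only [shiftGate]
      refine frac_le (Real.exp_pos (c y k + -(2 * r)))
        (Finset.sum_nonneg fun l _ => (Real.exp_pos _).le) (Real.exp_pos (w y k))
        (Finset.sum_nonneg fun l _ => (Real.exp_pos _).le) ?_
      rw [Finset.mul_sum, Finset.mul_sum]
      refine Finset.sum_le_sum fun l _ => ?_
      rw [← Real.exp_add, ← Real.exp_add, Real.exp_le_exp]
      have h1 := abs_le.1 (hwc y k)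
      have h2 := abs_le.1 (hwc y l)
      linarith [h1.1, h1.2, h2.1, h2.2]
    · intro y k
      show Real.exp (w y k) / ∑ l, Real.exp (w y l) ≤ shiftGate (2 * r) c y k
      rw [softmax_eq]
      simp only [shiftGate]
      refine frac_le (Real.exp_pos (w y k))
        (Finset.sum_nonneg fun l _ => (Real.exp_pos _).le) (Real.exp_pos (c y k + 2 * r))
        (Finset.sum_nonneg fun l _ => (Real.exp_pos _).le) ?_
      rw [Finset.mul_sum, Finset.mul_sum]
      refine Finset.sum_le_sum fun l _ => ?_
      rw [← Real.exp_add, ← Real.exp_add, Real.exp_le_exp]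
      have h1 := abs_le.1 (hwc y k)
      have h2 := abs_le.1 (hwc y l)
      linarith [h1.1, h1.2, h2.1, h2.2]
end
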